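/- Fix t ∈ (0,1]. For every β ∈ ℝ, lim_{d→∞} limsup_{n→∞} E[⟨R_{1,2}(σ1,σ2)²⟩^bis_{β/√d, A, A_t}] = 0, where the expectation is over the coupled pair (A, A_t) of sparse disorders with perturbation parameter t, and ⟨·⟩^bis_{β/√d,A,A_t} is the coupled bisection Gibbs average with σ1 ~ μ^bis_{β/√d,A} and σ2 ~ μ^bis_{β/√d,A_t} independent. -/

import Mathlib

open MeasureTheory ProbabilityTheory Filter

noncomputable section

/-- The value of a ±1 spin encoded as a Boolean. -/
def spin (b : Bool) : ℝ := if b then 1 else -1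

/-- The Ising Hamiltonian `H(σ; X) = ∑_{i,j} X i j σ(i) σ(j)`. -/
def Ham {n : ℕ} (X : Fin n → Fin n → ℝ) (σ : Fin n → Bool) : ℝ :=
  ∑ i, ∑ j, X i j * spin (σ i) * spin (σ j)

/-- The partition function `Z(β, X)`. -/
def Zpart {n : ℕ} (β : ℝ) (X : Fin n → Fin n → ℝ) : ℝ :=
  ∑ σ : Fin n → Bool, Real.exp (-β * Ham X σ)

/-- The Gibbs probability mass function `μ_{β,X}(σ)`. -/
def gibbs {n : ℕ} (β : ℝ) (X : Fin n → Fin n → ℝ) (σ : Fin n → Bool) : ℝ :=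
  Real.exp (-β * Ham X σ) / Zpart β X

/-- A configuration is a bisection if `|∑ i σ(i)| ≤ 1`. -/
def isBis {n : ℕ} (σ : Fin n → Bool) : Prop := |∑ i, spin (σ i)| ≤ 1

open scoped Classical in
/-- The bisection partition function `Z^bis(β, X)`. -/
def ZpartBis {n : ℕ} (β : ℝ) (X : Fin n → Fin n → ℝ) : ℝ :=
  ∑ σ : Fin n → Bool, if isBis σ then Real.exp (-β * Ham X σ) else 0

open scoped Classical in
/-- The bisection Gibbs probability mass function `μ^bis_{β,X}(σ)`. -/
def gibbsBis {n : ℕ} (β : ℝ) (X : Fin n → Fin n → ℝ) (σ : Fin n → Bool) : ℝ :=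
  if isBis σ then Real.exp (-β * Ham X σ) / ZpartBis β X else 0

/-- The overlap `R_{1,2}(σ1, σ2) = (1/n) ∑ i σ1(i) σ2(i)`. -/
def overlap {n : ℕ} (σ1 σ2 : Fin n → Bool) : ℝ :=
  (1 / (n : ℝ)) * ∑ i, spin (σ1 i) * spin (σ2 i)

/-- Gibbs average of a one-variable observable. -/
def avg1 {n : ℕ} (β : ℝ) (X : Fin n → Fin n → ℝ) (f : (Fin n → Bool) → ℝ) : ℝ :=
  ∑ σ : Fin n → Bool, f σ * gibbs β X σ

/-- Bisection Gibbs average of a one-variable observable. -/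
def avg1Bis {n : ℕ} (β : ℝ) (X : Fin n → Fin n → ℝ) (f : (Fin n → Bool) → ℝ) : ℝ :=
  ∑ σ : Fin n → Bool, f σ * gibbsBis β X σ

/-- Coupled Gibbs average: `σ1 ~ μ_{β,X}`, `σ2 ~ μ_{β,Y}` independent. -/
def avg2c {n : ℕ} (β : ℝ) (X Y : Fin n → Fin n → ℝ)
    (f : (Fin n → Bool) → (Fin n → Bool) → ℝ) : ℝ :=
  ∑ σ1 : Fin n → Bool, ∑ σ2 : Fin n → Bool, f σ1 σ2 * gibbs β X σ1 * gibbs β Y σ2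

/-- Gibbs average of a two-replica observable. -/
def avg2 {n : ℕ} (β : ℝ) (X : Fin n → Fin n → ℝ)
    (f : (Fin n → Bool) → (Fin n → Bool) → ℝ) : ℝ :=
  avg2c β X X f

/-- Coupled bisection Gibbs average. -/
def avg2cBis {n : ℕ} (β : ℝ) (X Y : Fin n → Fin n → ℝ)
    (f : (Fin n → Bool) → (Fin n → Bool) → ℝ) : ℝ :=
  ∑ σ1 : Fin n → Bool, ∑ σ2 : Fin n → Bool, f σ1 σ2 * gibbsBis β X σ1 * gibbsBis β Y σ2

/-- Bisection Gibbs average of a two-replica observable. -/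
def avg2Bis {n : ℕ} (β : ℝ) (X : Fin n → Fin n → ℝ)
    (f : (Fin n → Bool) → (Fin n → Bool) → ℝ) : ℝ :=
  avg2cBis β X X f

/-- The SK disorder: i.i.d. entries `N(0, 1/(2n))`. -/
def skMeasure (n : ℕ) : Measure (Fin n → Fin n → ℝ) :=
  Measure.pi fun _ => Measure.pi fun _ => gaussianReal 0 (1 / (2 * n))

/-- The law of the pair `(g, g')` of independent SK disorders. -/
def skPair (n : ℕ) : Measure ((Fin n → Fin n → ℝ) × (Fin n → Fin n → ℝ)) :=
  (skMeasure n).prod (skMeasure n)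

/-- The perturbed SK disorder `g_t = √(1-t) g + √t g'`. -/
def skPerturb {n : ℕ} (t : ℝ) (g g' : Fin n → Fin n → ℝ) : Fin n → Fin n → ℝ :=
  fun i j => Real.sqrt (1 - t) * g i j + Real.sqrt t * g' i j

/-- The sparse disorder: i.i.d. entries `Poisson(d/(2n))`. -/
def sparseMeasure (n : ℕ) (d : ℝ) : Measure (Fin n → Fin n → ℕ) :=
  Measure.pi fun _ => Measure.pi fun _ => poissonMeasure (d / (2 * n)).toNNReal

/-- The law of the triple `(A^{(1-t)}, A^{(t,1)}, A^{(t,2)})` of independent sparse disorders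
used to build the coupled pair `A = A^{(1-t)} + A^{(t,1)}`, `A_t = A^{(1-t)} + A^{(t,2)}`. -/
def coupledSparse (n : ℕ) (d t : ℝ) :
    Measure ((Fin n → Fin n → ℕ) × (Fin n → Fin n → ℕ) × (Fin n → Fin n → ℕ)) :=
  (sparseMeasure n ((1 - t) * d)).prod
    ((sparseMeasure n (t * d)).prod (sparseMeasure n (t * d)))

/-- View an ℕ-valued matrix as a real matrix. -/
def natMat {n : ℕ} (A : Fin n → Fin n → ℕ) : Fin n → Fin n → ℝ := fun i j => (A i j : ℝ)

/-- The Gibbs measure `μ_{β,X}` as a probability measure on configurations. -/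
def gibbsMeasure {n : ℕ} (β : ℝ) (X : Fin n → Fin n → ℝ) : Measure (Fin n → Bool) :=
  ∑ σ : Fin n → Bool, ENNReal.ofReal (gibbs β X σ) • Measure.dirac σ

/-- The bisection Gibbs measure `μ^bis_{β,X}` as a measure on configurations. -/
def gibbsBisMeasure {n : ℕ} (β : ℝ) (X : Fin n → Fin n → ℝ) : Measure (Fin n → Bool) :=
  ∑ σ : Fin n → Bool, ENNReal.ofReal (gibbsBis β X σ) • Measure.dirac σ

/-- Normalized Wasserstein distance `W_{2,n}` between measures on `{-1,1}^n`. -/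
def W2 (n : ℕ) (μ1 μ2 : Measure (Fin n → Bool)) : ℝ :=
  sInf {r : ℝ | ∃ π : Measure ((Fin n → Bool) × (Fin n → Bool)),
    IsProbabilityMeasure π ∧ π.map Prod.fst = μ1 ∧ π.map Prod.snd = μ2 ∧
    r = Real.sqrt (∫ p, (1 / (n : ℝ)) * ∑ i, (spin (p.1 i) - spin (p.2 i)) ^ 2 ∂π)}

open scoped Classical in
/-- Overlap-restricted coupled partition function `Z^S_{X,Y}`. -/
def Zres {n : ℕ} (β : ℝ) (S : Set ℝ) (X Y : Fin n → Fin n → ℝ) : ℝ :=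
  ∑ σ1 : Fin n → Bool, ∑ σ2 : Fin n → Bool,
    if overlap σ1 σ2 ∈ S then Real.exp (-β * (Ham X σ1 + Ham Y σ2)) else 0

open scoped Classical in
/-- Overlap-restricted coupled bisection partition function `Z^{S,bis}_{X,Y}`. -/
def ZresBis {n : ℕ} (β : ℝ) (S : Set ℝ) (X Y : Fin n → Fin n → ℝ) : ℝ :=
  ∑ σ1 : Fin n → Bool, ∑ σ2 : Fin n → Bool,
    if isBis σ1 ∧ isBis σ2 ∧ overlap σ1 σ2 ∈ S
    then Real.exp (-β * (Ham X σ1 + Ham Y σ2)) else 0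

/-- The matrix with a single `1` in position `(i,j)`. -/
def Jmat {n : ℕ} (i j : Fin n) : Fin n → Fin n → ℝ :=
  fun a b => if a = i ∧ b = j then 1 else 0

end

open scoped NNReal

/-- The law of a finite sum of independent variables whose laws belong to a convolution
semigroup. -/
lemma map_finsetSum_pi_of_conv_semigroup {ι R M : Type*} [Fintype ι] [AddCommMonoid R]
    [AddCommMonoid M] [MeasurableSpace M] [MeasurableAdd₂ M] {X : ι → Type*}
    [∀ i, MeasurableSpace (X i)] (μ : ∀ i, Measure (X i)) [∀ i, IsProbabilityMeasure (μ i)]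
    (L : R → Measure M) (hL0 : L 0 = Measure.dirac 0) (hL : ∀ x y, L (x + y) = L x ∗ L y)
    (f : ∀ i, X i → M) (hf : ∀ i, Measurable (f i)) (ρ : ι → R)
    (h : ∀ i, (μ i).map (f i) = L (ρ i)) (s : Finset ι) :
    (Measure.pi μ).map (fun x => ∑ i ∈ s, f i (x i)) = L (∑ i ∈ s, ρ i) := by
  classical
  have hm : ∀ i, Measurable fun x : (∀ i, X i) => f i (x i) := fun i =>
    (hf i).comp (measurable_pi_apply i)
  have hI : iIndepFun (fun i (x : ∀ i, X i) => f i (x i)) (Measure.pi μ) :=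
    iIndepFun_pi fun i => (hf i).aemeasurable
  induction s using Finset.induction_on with
  | empty => simp [hL0]
  | insert a s ha ih =>
    have hd := (hI.indepFun_finsetSum_of_notMem hm ha).symm
    have e : (fun x : (∀ i, X i) => ∑ i ∈ insert a s, f i (x i))
        = (fun x => f a (x a)) + ∑ i ∈ s, fun x => f i (x i) := by
      ext x; simp [Finset.sum_insert ha]
    have e' : (∑ i ∈ s, fun x : (∀ i, X i) => f i (x i)) = fun x => ∑ i ∈ s, f i (x i) := by
      ext x; simp
    have ea : (Measure.pi μ).map (fun x => f a (x a)) = L (ρ a) := by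
      rw [← h a, ← (measurePreserving_eval μ a).map_eq, Measure.map_map (hf a)
        (measurable_pi_apply a)]
      rfl
    rw [e, hd.map_add_eq_map_conv_map (hm a) (by rw [e']; fun_prop), e', ih, ea,
      Finset.sum_insert ha, hL]

lemma pi_conv_pi {ι M : Type*} [Fintype ι] [AddCommMonoid M] [MeasurableSpace M]
    [MeasurableAdd₂ M] (μ ν : ι → Measure M) [∀ i, IsProbabilityMeasure (μ i)]
    [∀ i, IsProbabilityMeasure (ν i)] :
    Measure.pi μ ∗ Measure.pi ν = Measure.pi fun i => μ i ∗ ν i := by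
  have h := (measurePreserving_arrowProdEquivProdArrow M M ι μ ν).map_eq
  rw [Measure.conv, ← h, Measure.map_map (by fun_prop) (by fun_prop)]
  unfold Measure.conv
  rw [← Measure.pi_map_pi (by fun_prop)]
  rfl

lemma pi_dirac {ι : Type*} [Fintype ι] {X : ι → Type*} [∀ i, MeasurableSpace (X i)]
    (x : ∀ i, X i) : (Measure.pi fun i => Measure.dirac (x i)) = Measure.dirac x := by
  refine Measure.pi_eq fun s hs => ?_
  rw [Measure.dirac_apply' _ (MeasurableSet.univ_pi hs)]
  simp only [Measure.dirac_apply' _ (hs _)]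
  by_cases h : x ∈ Set.univ.pi s
  · rw [Set.indicator_of_mem h]
    exact (Finset.prod_eq_one fun i _ => Set.indicator_of_mem (h i trivial) _).symm
  · rw [Set.indicator_of_notMem h]
    simp only [Set.mem_univ_pi, not_forall] at h
    obtain ⟨i, hi⟩ := h
    exact (Finset.prod_eq_zero (Finset.mem_univ i) (Set.indicator_of_notMem hi _)).symm

lemma poissonMeasure_zero : poissonMeasure 0 = Measure.dirac 0 := by
  refine Measure.ext_of_singleton fun k => ?_
  rw [poissonMeasure_singleton]
  rcases k with _ | k <;> simp

lemma hasSum_poisson_shift (r : ℝ≥0) (m : ℕ) :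
    HasSum (fun k : ℕ => Real.exp (-r) * (r : ℝ) ^ k / (k.factorial : ℝ) * (k.descFactorial m : ℝ))
      ((r : ℝ) ^ m) := by
  have h := (hasSum_one_poissonMeasure r).mul_left ((r : ℝ) ^ m)
  rw [mul_one] at h
  rw [← hasSum_nat_add_iff' m]
  have : ∑ i ∈ Finset.range m, Real.exp (-r) * (r : ℝ) ^ i / (i.factorial : ℝ)
      * (i.descFactorial m : ℝ) = 0 :=
    Finset.sum_eq_zero fun i hi => by
      rw [Nat.descFactorial_of_lt (Finset.mem_range.mp hi)]; simp
  rw [this, sub_zero]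
  convert! h using 2 with k
  have e : ((k + m).factorial : ℝ) = k.factorial * ((k + m).descFactorial m : ℝ) := by
    rw [← Nat.factorial_mul_descFactorial (Nat.le_add_left m k)]
    simp
  have hk : (k.factorial : ℝ) ≠ 0 := by positivity
  have hd : ((k + m).descFactorial m : ℝ) ≠ 0 := by
    intro h0
    rw [h0, mul_zero] at e
    exact (by positivity : ((k + m).factorial : ℝ) ≠ 0) e
  rw [e]
  field_simp
  ring

lemma integrable_descFactorial_poisson (r : ℝ≥0) (m : ℕ) :
    Integrable (fun k : ℕ => (k.descFactorial m : ℝ)) (poissonMeasure r) := by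
  rw [integrable_poissonMeasure_iff]
  simpa using (hasSum_poisson_shift r m).summable

lemma integral_descFactorial_poisson (r : ℝ≥0) (m : ℕ) :
    ∫ k, (k.descFactorial m : ℝ) ∂(poissonMeasure r) = (r : ℝ) ^ m := by
  rw [integral_poissonMeasure]
  exact (hasSum_poisson_shift r m).tsum_eq

/-- Matrices of multiplicities. -/
abbrev CountMat (n : ℕ) : Type := Fin n → Fin n → ℕ

/-- Matrices with i.i.d. Poisson entries of rate `r`. -/
noncomputable def poissonMat (n : ℕ) (r : ℝ≥0) : Measure (CountMat n) :=
  Measure.pi fun _ => Measure.pi fun _ => poissonMeasure r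

instance (n : ℕ) (r : ℝ≥0) : IsProbabilityMeasure (poissonMat n r) := by
  unfold poissonMat; infer_instance

lemma poissonMat_add (n : ℕ) (r r' : ℝ≥0) :
    poissonMat n (r + r') = poissonMat n r ∗ poissonMat n r' := by
  unfold poissonMat
  rw [pi_conv_pi]
  congr 1
  ext1 i
  rw [pi_conv_pi]
  congr 1
  ext1 i
  rw [poissonMeasure_conv_poissonMeasure]

lemma poissonMat_zero (n : ℕ) : poissonMat n 0 = Measure.dirac 0 := by
  unfold poissonMat
  simp_rw [poissonMeasure_zero, pi_dirac]
  rfl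

/-- The total number of points of a matrix of multiplicities. -/
def total {n : ℕ} (A : CountMat n) : ℕ := ∑ i, ∑ j, A i j

lemma total_add {n : ℕ} (A B : CountMat n) : total (A + B) = total A + total B := by
  simp [total, Finset.sum_add_distrib]

lemma total_zero {n : ℕ} : total (0 : CountMat n) = 0 := by simp [total]

lemma map_total_poissonMat (n : ℕ) (r : ℝ≥0) :
    (poissonMat n r).map total = poissonMeasure (n * (n * r)) := by
  have row := map_finsetSum_pi_of_conv_semigroup (fun _ : Fin n => poissonMeasure r) poissonMeasure
    poissonMeasure_zero (fun x y => (poissonMeasure_conv_poissonMeasure x y).symm)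
    (fun _ => id) (fun _ => measurable_id) (fun _ => r) (fun _ => Measure.map_id) Finset.univ
  have := map_finsetSum_pi_of_conv_semigroup
    (fun _ : Fin n => Measure.pi fun _ : Fin n => poissonMeasure r)
    poissonMeasure
    poissonMeasure_zero (fun x y => (poissonMeasure_conv_poissonMeasure x y).symm)
    (fun _ x => ∑ j, x j) (fun _ => .of_discrete) (fun _ => n * r)
    (fun _ => by simpa using row) Finset.univ
  simp only [Finset.sum_const, Finset.card_univ, Fintype.card_fin, nsmul_eq_mul] at this
  exact this

lemma integrable_descFactorial_total (n : ℕ) (r : ℝ≥0) (m : ℕ) :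
    Integrable (fun A : CountMat n => ((total A).descFactorial m : ℝ)) (poissonMat n r) := by
  have h := integrable_descFactorial_poisson (n * (n * r)) m
  rw [← map_total_poissonMat, integrable_map_measure .of_discrete
    Measurable.of_discrete.aemeasurable] at h
  exact h

lemma integral_descFactorial_total (n : ℕ) (r : ℝ≥0) (m : ℕ) :
    ∫ A, ((total A).descFactorial m : ℝ) ∂(poissonMat n r) = ((n : ℝ) * (n * r)) ^ m := by
  have h := integral_descFactorial_poisson (n * (n * r)) m
  rw [← map_total_poissonMat, integral_map Measurable.of_discrete.aemeasurable .of_discrete] at h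
  simpa using h

lemma integrable_total (n : ℕ) (r : ℝ≥0) :
    Integrable (fun A : CountMat n => (total A : ℝ)) (poissonMat n r) := by
  simpa using integrable_descFactorial_total n r 1

lemma integral_total (n : ℕ) (r : ℝ≥0) :
    ∫ A, (total A : ℝ) ∂(poissonMat n r) = (n : ℝ) * (n * r) := by
  simpa using integral_descFactorial_total n r 1

lemma map_entry_poissonMat (n : ℕ) (r : ℝ≥0) (i j : Fin n) :
    (poissonMat n r).map (fun A => A i j) = poissonMeasure r := by
  have h1 := measurePreserving_eval
    (fun _ : Fin n => Measure.pi fun _ : Fin n => poissonMeasure r) i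
  have h2 := (measurePreserving_eval (fun _ : Fin n => poissonMeasure r) j)
  exact (h2.comp h1).map_eq

lemma integrable_entry (n : ℕ) (r : ℝ≥0) (i j : Fin n) :
    Integrable (fun A : CountMat n => (A i j : ℝ)) (poissonMat n r) := by
  have h := integrable_descFactorial_poisson r 1
  rw [← map_entry_poissonMat n r i j,
    integrable_map_measure .of_discrete Measurable.of_discrete.aemeasurable] at h
  simpa [Function.comp_def] using h

lemma integral_entry (n : ℕ) (r : ℝ≥0) (i j : Fin n) :
    ∫ A, (A i j : ℝ) ∂(poissonMat n r) = r := by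
  have h := integral_descFactorial_poisson r 1
  rw [← map_entry_poissonMat n r i j,
    integral_map Measurable.of_discrete.aemeasurable .of_discrete] at h
  simpa using h

/-- The matrix with a single point at `(i, j)`. -/
def unitMat {n : ℕ} (i j : Fin n) : CountMat n := Pi.single i (Pi.single j 1)

lemma sum_unitMat_mul {n : ℕ} (i j : Fin n) (f : Fin n → Fin n → ℝ) :
    ∑ k, ∑ l, ((unitMat i j k l : ℕ) : ℝ) * f k l = f i j := by
  rw [Finset.sum_eq_single i, Finset.sum_eq_single j]
  · simp [unitMat]
  · intro l _ hl; simp [unitMat, hl]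
  · simp
  · intro k _ hk; simp [unitMat, hk]
  · simp

lemma cast_total {n : ℕ} (N : CountMat n) : (total N : ℝ) = ∑ i, ∑ j, (N i j : ℝ) := by
  simp [total]

lemma total_unitMat {n : ℕ} (i j : Fin n) : total (unitMat i j) = 1 := by
  have h := sum_unitMat_mul i j (fun _ _ => 1)
  simp only [mul_one] at h
  rw [← cast_total] at h
  exact_mod_cast h

lemma eq_zero_of_total_eq_zero {n : ℕ} {N : CountMat n} (h : total N = 0) : N = 0 := by
  ext i j
  simp only [total, Finset.sum_eq_zero_iff, Finset.mem_univ, true_implies] at h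
  exact h i j

lemma exists_eq_unitMat_of_total_eq_one {n : ℕ} {N : CountMat n} (h : total N = 1) :
    ∃ i j, N = unitMat i j := by
  have hN : ∃ i j, N i j ≠ 0 := by
    by_contra! hc
    have : N = 0 := by ext i j; exact hc i j
    rw [this, total_zero] at h
    exact zero_ne_one h
  obtain ⟨i, j, hij⟩ := hN
  refine ⟨i, j, ?_⟩
  have hle : unitMat i j ≤ N := by
    intro k l
    by_cases hk : k = i
    · subst hk
      by_cases hl : l = j
      · subst hl; simpa [unitMat] using Nat.one_le_iff_ne_zero.mpr hij
      · simp [unitMat, hl]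
    · simp [unitMat, hk]
  have he : N - unitMat i j + unitMat i j = N := by
    ext k l; exact Nat.sub_add_cancel (hle k l)
  have ht := total_add (N - unitMat i j) (unitMat i j)
  rw [he, h, total_unitMat] at ht
  have h0 := eq_zero_of_total_eq_zero (N := N - unitMat i j) (by omega)
  rw [← he, h0, zero_add]

lemma abs_sub_firstOrder_le {n : ℕ} {F : CountMat n → ℝ} {C : ℝ}
    (h : ∀ N, |F N - F 0| ≤ C * total N) (N : CountMat n) :
    |F N - F 0 - ∑ i, ∑ j, (N i j : ℝ) * (F (unitMat i j) - F 0)|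
      ≤ 2 * C * (total N).descFactorial 2 := by
  rcases Nat.lt_or_ge (total N) 2 with h2 | h2
  · interval_cases hN : total N
    · simp [eq_zero_of_total_eq_zero hN]
    · obtain ⟨i, j, rfl⟩ := exists_eq_unitMat_of_total_eq_one hN
      rw [sum_unitMat_mul i j (fun k l => F (unitMat k l) - F 0)]
      simp
  · have hlin : |∑ i, ∑ j, (N i j : ℝ) * (F (unitMat i j) - F 0)| ≤ C * total N := by
      rw [cast_total, Finset.mul_sum]
      refine (Finset.abs_sum_le_sum_abs _ _).trans (Finset.sum_le_sum fun i _ => ?_)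
      rw [Finset.mul_sum]
      refine (Finset.abs_sum_le_sum_abs _ _).trans (Finset.sum_le_sum fun j _ => ?_)
      have := h (unitMat i j)
      rw [total_unitMat, Nat.cast_one, mul_one] at this
      rw [abs_mul, Nat.abs_cast, mul_comm C]
      exact mul_le_mul_of_nonneg_left this (Nat.cast_nonneg _)
    have hC : 0 ≤ C * total N := (abs_nonneg _).trans (h N)
    have hd : (total N : ℝ) ≤ (total N).descFactorial 2 := by
      rw [show (total N).descFactorial 2 = (total N - 1) * (total N * 1) by
        simp [Nat.descFactorial]]
      exact_mod_cast by nlinarith [Nat.sub_add_cancel (show 1 ≤ total N by omega)]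
    have hC0 : 0 ≤ C := by
      have h3 : (0 : ℝ) < total N := by exact_mod_cast (by omega : 0 < total N)
      exact nonneg_of_mul_nonneg_left hC h3
    calc _ ≤ |F N - F 0| + |∑ i, ∑ j, (N i j : ℝ) * (F (unitMat i j) - F 0)| := abs_sub _ _
      _ ≤ 2 * C * total N := by linarith [h N]
      _ ≤ _ := mul_le_mul_of_nonneg_left hd (by positivity)

lemma integrable_of_abs_sub_le_total {n : ℕ} {F : CountMat n → ℝ} {C : ℝ}
    (h : ∀ N, |F N - F 0| ≤ C * total N) (r : ℝ≥0) : Integrable F (poissonMat n r) := by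
  refine ((integrable_const |F 0|).add ((integrable_total n r).const_mul C)).mono'
    .of_discrete (Eventually.of_forall fun N => ?_)
  have := abs_add_le (F N - F 0) (F 0)
  rw [sub_add_cancel] at this
  simp only [Pi.add_apply, Real.norm_eq_abs]
  linarith [h N]

lemma abs_integral_sub_firstOrder_le {n : ℕ} {F : CountMat n → ℝ} {C : ℝ}
    (h : ∀ N, |F N - F 0| ≤ C * total N) (r : ℝ≥0) :
    |∫ N, F N ∂(poissonMat n r) - F 0 - r * ∑ i, ∑ j, (F (unitMat i j) - F 0)|
      ≤ 2 * C * ((n : ℝ) * (n * r)) ^ 2 := by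
  have hF := integrable_of_abs_sub_le_total h r
  have hlin : Integrable (fun N : CountMat n =>
      ∑ i, ∑ j, (N i j : ℝ) * (F (unitMat i j) - F 0)) (poissonMat n r) :=
    integrable_finsetSum _ fun i _ => integrable_finsetSum _ fun j _ =>
      (integrable_entry n r i j).mul_const _
  have e : ∫ N, F N ∂(poissonMat n r) - F 0 - r * ∑ i, ∑ j, (F (unitMat i j) - F 0)
      = ∫ N, (F N - F 0 - ∑ i, ∑ j, (N i j : ℝ) * (F (unitMat i j) - F 0)) ∂(poissonMat n r) := by
    have hsub : Integrable (fun N => F N - F 0) (poissonMat n r) := hF.sub (integrable_const _)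
    rw [integral_sub hsub hlin, integral_sub hF (integrable_const _),
      integral_finsetSum _ fun i _ => integrable_finsetSum _ fun j _ =>
        (integrable_entry n r i j).mul_const _]
    simp_rw [integral_finsetSum _ fun j _ =>
        (integrable_entry n r _ j).mul_const _, integral_mul_const, integral_entry]
    simp only [integral_const, probReal_univ, one_smul, Finset.mul_sum]
  rw [e, ← integral_descFactorial_total, ← integral_const_mul]
  rw [← Real.norm_eq_abs]
  exact norm_integral_le_of_norm_le ((integrable_descFactorial_total n r 2).const_mul (2 * C))
    (Eventually.of_forall fun N => abs_sub_firstOrder_le h N)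

/-- The law of `(K + U, K + V)` for independent Poisson matrices `K`, `U`, `V` of rates
`a`, `u`, `v`. -/
noncomputable def pairLaw (n : ℕ) (a u v : ℝ≥0) : Measure (CountMat n × CountMat n) :=
  (poissonMat n a).map ((AddMonoidHom.id _).prod (AddMonoidHom.id _)) ∗
    ((poissonMat n u).map (AddMonoidHom.inl _ _) ∗ (poissonMat n v).map (AddMonoidHom.inr _ _))

section pairLaw
variable {n : ℕ} (a a' u u' v v' : ℝ≥0)

instance : IsProbabilityMeasure
    ((poissonMat n a).map ((AddMonoidHom.id (CountMat n)).prod (AddMonoidHom.id (CountMat n)))) :=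
  Measure.isProbabilityMeasure_map .of_discrete

instance : IsProbabilityMeasure
    ((poissonMat n a).map (AddMonoidHom.inl (CountMat n) (CountMat n))) :=
  Measure.isProbabilityMeasure_map .of_discrete

instance : IsProbabilityMeasure
    ((poissonMat n a).map (AddMonoidHom.inr (CountMat n) (CountMat n))) :=
  Measure.isProbabilityMeasure_map .of_discrete

instance : IsProbabilityMeasure (pairLaw n a u v) := by
  unfold pairLaw
  exact Measure.probabilitymeasure_of_probabilitymeasures_conv _ _

lemma conv_conv_conv_comm {M : Type*} [AddCommMonoid M] [MeasurableSpace M] [MeasurableAdd₂ M]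
    (μ ν ρ τ : Measure M) [SFinite μ] [SFinite ν] [SFinite ρ] [SFinite τ] :
    (μ ∗ ν) ∗ (ρ ∗ τ) = (μ ∗ ρ) ∗ (ν ∗ τ) := by
  rw [Measure.conv_assoc, ← Measure.conv_assoc ν, Measure.conv_comm ν, Measure.conv_assoc ρ,
    ← Measure.conv_assoc μ]

lemma pairLaw_add :
    pairLaw n (a + a') (u + u') (v + v') = pairLaw n a u v ∗ pairLaw n a' u' v' := by
  unfold pairLaw
  rw [poissonMat_add, poissonMat_add, poissonMat_add,
    Measure.map_conv_addMonoidHom _ .of_discrete,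
    Measure.map_conv_addMonoidHom _ .of_discrete, Measure.map_conv_addMonoidHom _ .of_discrete,
    conv_conv_conv_comm (Measure.map (AddMonoidHom.inl _ _) _), conv_conv_conv_comm]

lemma pairLaw_diag : pairLaw n a 0 0 = (poissonMat n a).map fun N => (N, N) := by
  unfold pairLaw
  simp only [poissonMat_zero, Measure.map_dirac' (Measurable.of_discrete), map_zero,
    Measure.conv_dirac_zero]
  rfl

lemma pairLaw_left : pairLaw n 0 u 0 = (poissonMat n u).map fun N => (N, 0) := by
  unfold pairLaw
  simp only [poissonMat_zero, Measure.map_dirac' (Measurable.of_discrete), map_zero,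
    Measure.conv_dirac_zero, Measure.dirac_zero_conv]
  rfl

lemma pairLaw_right : pairLaw n 0 0 v = (poissonMat n v).map fun N => (0, N) := by
  unfold pairLaw
  simp only [poissonMat_zero, Measure.map_dirac' (Measurable.of_discrete), map_zero,
    Measure.dirac_zero_conv]
  rfl

lemma pairLaw_zero : pairLaw n 0 0 0 = Measure.dirac 0 := by
  rw [pairLaw_diag, poissonMat_zero, Measure.map_dirac' .of_discrete]
  rfl

lemma pairLaw_zero_left : pairLaw n 0 u v = (poissonMat n u).prod (poissonMat n v) := by
  unfold pairLaw
  rw [poissonMat_zero, Measure.map_dirac' .of_discrete, map_zero, Measure.dirac_zero_conv,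
    Measure.conv, Measure.map_prod_map _ _ .of_discrete .of_discrete,
    Measure.map_map .of_discrete .of_discrete]
  convert! Measure.map_id
  ext p <;> simp

lemma pairLaw_eq_map : pairLaw n a u v =
    ((poissonMat n a).prod ((poissonMat n u).prod (poissonMat n v))).map
      fun w => (w.1 + w.2.1, w.1 + w.2.2) := by
  have h : pairLaw n a u v = pairLaw n a 0 0 ∗ pairLaw n 0 u v := by
    rw [← pairLaw_add]; simp
  rw [h, pairLaw_diag, pairLaw_zero_left, Measure.conv]
  nth_rw 1 [← Measure.map_id (μ := (poissonMat n u).prod (poissonMat n v))]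
  rw [Measure.map_prod_map _ _ .of_discrete .of_discrete,
    Measure.map_map .of_discrete .of_discrete]
  rfl

lemma map_fst_pairLaw : (pairLaw n a u v).map Prod.fst = poissonMat n (a + u) := by
  rw [pairLaw_eq_map, Measure.map_map .of_discrete .of_discrete, poissonMat_add, Measure.conv]
  have : (Prod.fst ∘ fun w : CountMat n × CountMat n × CountMat n => (w.1 + w.2.1, w.1 + w.2.2))
    = (fun p : CountMat n × CountMat n => p.1 + p.2) ∘ Prod.map id Prod.fst := rfl
  rw [this, ← Measure.map_map .of_discrete .of_discrete,
    ← Measure.map_prod_map _ _ .of_discrete .of_discrete, Measure.map_fst_prod]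
  simp

lemma map_snd_pairLaw : (pairLaw n a u v).map Prod.snd = poissonMat n (a + v) := by
  rw [pairLaw_eq_map, Measure.map_map .of_discrete .of_discrete, poissonMat_add, Measure.conv]
  have : (Prod.snd ∘ fun w : CountMat n × CountMat n × CountMat n => (w.1 + w.2.1, w.1 + w.2.2))
    = (fun p : CountMat n × CountMat n => p.1 + p.2) ∘ Prod.map id Prod.snd := rfl
  rw [this, ← Measure.map_map .of_discrete .of_discrete,
    ← Measure.map_prod_map _ _ .of_discrete .of_discrete, Measure.map_snd_prod]
  simp

end pairLaw

/-- Functions of two matrices which are Lipschitz in the number of points. -/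
def LipPair {n : ℕ} (B : ℝ) (G : CountMat n × CountMat n → ℝ) : Prop :=
  ∀ p q, |G (p + q) - G p| ≤ B * (total q.1 + total q.2)

lemma LipPair.integrable {n : ℕ} {B : ℝ} {G : CountMat n × CountMat n → ℝ} (h : LipPair B G)
    (a u v : ℝ≥0) : Integrable G (pairLaw n a u v) := by
  have h1 : Integrable (fun p : CountMat n × CountMat n => (total p.1 : ℝ)) (pairLaw n a u v) := by
    have := integrable_total n (a + u)
    rw [← map_fst_pairLaw a u v, integrable_map_measure .of_discrete
      Measurable.of_discrete.aemeasurable] at this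
    exact this
  have h2 : Integrable (fun p : CountMat n × CountMat n => (total p.2 : ℝ)) (pairLaw n a u v) := by
    have := integrable_total n (a + v)
    rw [← map_snd_pairLaw a u v, integrable_map_measure .of_discrete
      Measurable.of_discrete.aemeasurable] at this
    exact this
  refine ((integrable_const |G 0|).add ((h1.add h2).const_mul B)).mono'
    .of_discrete (Eventually.of_forall fun p => ?_)
  have := abs_add_le (G p - G 0) (G 0)
  have h3 := h 0 p
  rw [zero_add] at h3
  rw [sub_add_cancel] at this
  simp only [Pi.add_apply, Real.norm_eq_abs]
  linarith

lemma LipPair.translate {n : ℕ} {B : ℝ} {G : CountMat n × CountMat n → ℝ} (h : LipPair B G)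
    (p : CountMat n × CountMat n) : LipPair B fun q => G (p + q) := fun q q' => by
  simpa only [add_assoc] using h (p + q) q'

lemma LipPair.integral_translate {n : ℕ} {B : ℝ} {G : CountMat n × CountMat n → ℝ}
    (h : LipPair B G) (a u v : ℝ≥0) :
    LipPair B fun p => ∫ q, G (p + q) ∂(pairLaw n a u v) := fun p q => by
  rw [← integral_sub ((h.translate (p + q)).integrable a u v) ((h.translate p).integrable a u v),
    ← Real.norm_eq_abs]
  refine (norm_integral_le_of_norm_le_const (C := B * (total q.1 + total q.2))
    (Eventually.of_forall fun q' => ?_)).trans (by simp)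
  rw [Real.norm_eq_abs, add_right_comm]
  exact h _ _

lemma LipPair.diag_step_le {n : ℕ} {B : ℝ} {G : CountMat n × CountMat n → ℝ}
    (h : LipPair B G) (p : CountMat n × CountMat n) (r : ℝ≥0) :
    ∫ q, G (p + q) ∂(pairLaw n r 0 0)
      ≤ G p + r * ∑ i, ∑ j, (G (p + (unitMat i j, unitMat i j)) - G p)
        + 4 * B * ((n : ℝ) * (n * r)) ^ 2 := by
  rw [pairLaw_diag, integral_map Measurable.of_discrete.aemeasurable .of_discrete]
  have := abs_integral_sub_firstOrder_le (F := fun N => G (p + (N, N))) (C := 2 * B)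
    (fun N => by
      have := h p (N, N)
      simp only [← Prod.zero_eq_mk, add_zero]
      linarith) r
  simp only [← Prod.zero_eq_mk, add_zero] at this
  linarith [(abs_le.mp this).2]

lemma LipPair.le_indep_step {n : ℕ} {B : ℝ} {G : CountMat n × CountMat n → ℝ}
    (h : LipPair B G) (p : CountMat n × CountMat n) (r : ℝ≥0) :
    G p + r * ∑ i, ∑ j, (G (p + (unitMat i j, 0)) - G p)
        + r * ∑ i, ∑ j, (G (p + (0, unitMat i j)) - G p)
        - 6 * B * ((n : ℝ) * (n * r)) ^ 2 ≤ ∫ q, G (p + q) ∂(pairLaw n 0 r r) := by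
  have hp := (h.translate p).integrable 0 r r
  rw [pairLaw_zero_left] at hp ⊢
  rw [integral_prod _ hp]
  set m : ℝ := (n : ℝ) * (n * r) with hm
  have inner (N : CountMat n) :
      G (p + (N, 0)) + (r * ∑ i, ∑ j, (G (p + (0, unitMat i j)) - G p) - 2 * B * m ^ 2
        - 2 * B * m * total N) ≤ ∫ N', G (p + (N, N')) ∂(poissonMat n r) := by
    have h1 := abs_integral_sub_firstOrder_le (F := fun N' => G (p + (N, N'))) (C := B)
      (fun N' => by
        have := h (p + (N, 0)) (0, N')
        rw [add_assoc, show (N, (0 : CountMat n)) + (0, N') = (N, N') by simp] at this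
        simpa [total_zero] using this) r
    have h2 : ∑ i : Fin n, ∑ j : Fin n, (G (p + (0, unitMat i j)) - G p)
        - n * (n * (2 * B * total N))
        ≤ ∑ i, ∑ j, (G (p + (N, unitMat i j)) - G (p + (N, 0))) := by
      have e : (n : ℝ) * (n * (2 * B * total N))
          = ∑ i : Fin n, ∑ j : Fin n, (2 * B * total N) := by simp
      rw [e, ← Finset.sum_sub_distrib]
      refine Finset.sum_le_sum fun i _ => ?_
      rw [← Finset.sum_sub_distrib]
      refine Finset.sum_le_sum fun j _ => ?_
      have h3 := h (p + (0, unitMat i j)) (N, 0)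
      have h4 := h p (N, 0)
      rw [add_assoc, show ((0 : CountMat n), unitMat i j) + (N, 0) = (N, unitMat i j) by simp]
        at h3
      simp only [total_zero, Nat.cast_zero, add_zero] at h3 h4
      linarith [(abs_le.mp h3).1, (abs_le.mp h4).2]
    have h5 := mul_le_mul_of_nonneg_left h2 r.coe_nonneg
    have h6 := (abs_le.mp h1).1
    simp only [← hm] at h6
    have h7 : (r : ℝ) * (n * (n * (2 * B * total N))) = 2 * B * m * total N := by rw [hm]; ring
    rw [mul_sub, h7] at h5
    linarith
  have hl : ∀ N, |G (p + (N, 0)) - G (p + (0, 0))| ≤ B * total N := fun N => by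
    have := h p (N, 0)
    simp only [← Prod.zero_eq_mk, add_zero]
    simpa [total_zero] using this
  have hN : Integrable (fun N => G (p + (N, 0))) (poissonMat n r) :=
    integrable_of_abs_sub_le_total hl r
  have ht := (integrable_total n r).const_mul (2 * B * m)
  have h8 := integral_mono (hN.add ((integrable_const (r * ∑ i, ∑ j,
    (G (p + (0, unitMat i j)) - G p) - 2 * B * m ^ 2)).sub ht)) hp.integral_prod_left inner
  have h9 := abs_integral_sub_firstOrder_le hl r
  have e8 := integral_add hN ((integrable_const (μ := poissonMat n r) (r * ∑ i, ∑ j,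
    (G (p + (0, unitMat i j)) - G p) - 2 * B * m ^ 2)).sub ht)
  have e9 := integral_sub (integrable_const (μ := poissonMat n r) (r * ∑ i, ∑ j,
    (G (p + (0, unitMat i j)) - G p) - 2 * B * m ^ 2)) ht
  rw [integral_const_mul, integral_total, ← hm, integral_const] at e9
  simp only [← Prod.zero_eq_mk, add_zero, probReal_univ, one_smul] at h8 h9 e8 e9
  simp only [Pi.add_apply, Pi.sub_apply] at h8 e8
  rw [e8, e9] at h8
  rw [← hm] at h9
  linarith [(abs_le.mp h9).1]

/-- One infinitesimal step turning shared randomness into independent randomness. -/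
lemma LipPair.integral_step_le {n : ℕ} {B : ℝ} {G G' : CountMat n × CountMat n → ℝ}
    (h : LipPair B G) (h' : LipPair B G') (a u r : ℝ≥0) {η : ℝ}
    (hstep : ∀ p, G p + r * ∑ i, ∑ j, (G (p + (unitMat i j, unitMat i j)) - G p)
      ≤ G' p + r * ∑ i, ∑ j, (G' (p + (unitMat i j, 0)) - G' p)
        + r * ∑ i, ∑ j, (G' (p + (0, unitMat i j)) - G' p) + η) :
    ∫ p, G p ∂(pairLaw n (a + r) u u)
      ≤ ∫ p, G' p ∂(pairLaw n a (u + r) (u + r)) + (η + 10 * B * ((n : ℝ) * (n * r)) ^ 2) := by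
  have e1 : pairLaw n (a + r) u u = pairLaw n a u u ∗ pairLaw n r 0 0 := by
    rw [← pairLaw_add]; simp
  have e2 : pairLaw n a (u + r) (u + r) = pairLaw n a u u ∗ pairLaw n 0 r r := by
    rw [← pairLaw_add]; simp
  have hi := h.integrable (a + r) u u
  have hi' := h'.integrable a (u + r) (u + r)
  rw [e1] at hi ⊢
  rw [e2] at hi' ⊢
  rw [integral_conv hi, integral_conv hi']
  have h1 := (h'.integral_translate 0 r r).integrable a u u
  have h2 := integral_mono ((h.integral_translate r 0 0).integrable a u u)
    (h1.add (integrable_const (η + 10 * B * ((n : ℝ) * (n * r)) ^ 2))) (fun p => by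
      have := h.diag_step_le p r
      have := h'.le_indep_step p r
      have := hstep p
      simp only [Pi.add_apply]
      linarith)
  refine h2.trans (le_of_eq ?_)
  have := integral_add h1 (integrable_const (μ := pairLaw n a u u)
    (η + 10 * B * ((n : ℝ) * (n * r)) ^ 2))
  simp only [integral_const, probReal_univ, one_smul] at this
  exact this

section weighted
variable {Ω : Type*} [Fintype Ω] {w : Ω → ℝ}

/-- The average of `f` with respect to the normalised weights `w`. -/
noncomputable def wavg (w f : Ω → ℝ) : ℝ := (∑ x, w x * f x) / ∑ x, w x

lemma wavg_nonneg (hw : ∀ x, 0 ≤ w x) {f : Ω → ℝ} (hf : ∀ x, 0 ≤ f x) : 0 ≤ wavg w f :=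
  div_nonneg (Finset.sum_nonneg fun x _ => mul_nonneg (hw x) (hf x))
    (Finset.sum_nonneg fun x _ => hw x)

lemma abs_wavg_le_one (hw : ∀ x, 0 ≤ w x) (hZ : 0 < ∑ x, w x) {f : Ω → ℝ}
    (hf : ∀ x, |f x| ≤ 1) : |wavg w f| ≤ 1 := by
  rw [wavg, abs_div, abs_of_pos hZ, div_le_one hZ]
  refine (Finset.abs_sum_le_sum_abs _ _).trans (Finset.sum_le_sum fun x _ => ?_)
  rw [abs_mul, abs_of_nonneg (hw x)]
  exact mul_le_of_le_one_right (hw x) (hf x)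

lemma wavg_sum {ι : Type*} (s : Finset ι) (f : ι → Ω → ℝ) :
    wavg w (fun x => ∑ i ∈ s, f i x) = ∑ i ∈ s, wavg w (f i) := by
  simp only [wavg, Finset.mul_sum, ← Finset.sum_div]
  rw [Finset.sum_comm]

lemma wavg_const_mul (c : ℝ) (f : Ω → ℝ) : wavg w (fun x => c * f x) = c * wavg w f := by
  rw [wavg, wavg, ← mul_div_assoc, Finset.mul_sum]
  congr 1
  exact Finset.sum_congr rfl fun x _ => by ring

lemma sum_mul_exp_pos (hw : ∀ x, 0 ≤ w x) (hZ : 0 < ∑ x, w x) (f : Ω → ℝ) :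
    0 < ∑ x, w x * Real.exp (f x) := by
  obtain ⟨x, -, hx⟩ := Finset.exists_lt_of_sum_lt (s := Finset.univ)
    (f := fun _ => (0 : ℝ)) (g := w) (by simpa using hZ)
  exact Finset.sum_pos' (fun y _ => mul_nonneg (hw y) (Real.exp_pos _).le)
    ⟨x, Finset.mem_univ _, mul_pos hx (Real.exp_pos _)⟩

lemma log_sum_add_wavg_le (hw : ∀ x, 0 ≤ w x) (hZ : 0 < ∑ x, w x) (f : Ω → ℝ) :
    Real.log (∑ x, w x) + wavg w f ≤ Real.log (∑ x, w x * Real.exp (f x)) := by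
  rw [Real.le_log_iff_exp_le (sum_mul_exp_pos hw hZ f), Real.exp_add, Real.exp_log hZ]
  set m := wavg w f with hm
  have h1 : ∑ x, w x * f x = m * ∑ x, w x := by rw [hm, wavg, div_mul_cancel₀ _ hZ.ne']
  calc (∑ x, w x) * Real.exp m
      = ∑ x, w x * (Real.exp m * (f x - m + 1)) := by
        have : ∀ x, w x * (Real.exp m * (f x - m + 1))
          = Real.exp m * (w x * f x) + (1 - m) * Real.exp m * w x := fun x => by ring
        simp_rw [this, Finset.sum_add_distrib, ← Finset.mul_sum, h1]
        ring
    _ ≤ _ := Finset.sum_le_sum fun x _ => mul_le_mul_of_nonneg_left (by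
        have := Real.add_one_le_exp (f x - m)
        calc Real.exp m * (f x - m + 1) ≤ Real.exp m * Real.exp (f x - m) :=
              mul_le_mul_of_nonneg_left this (Real.exp_pos _).le
          _ = Real.exp (f x) := by rw [← Real.exp_add]; ring_nf) (hw x)

lemma log_sum_exp_le (hw : ∀ x, 0 ≤ w x) (hZ : 0 < ∑ x, w x) {f : Ω → ℝ} {a : ℝ}
    (hf : ∀ x, f x ≤ a) :
    Real.log (∑ x, w x * Real.exp (f x)) ≤ Real.log (∑ x, w x) + a := by
  rw [Real.log_le_iff_le_exp (sum_mul_exp_pos hw hZ f), Real.exp_add, Real.exp_log hZ,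
    Finset.sum_mul]
  exact Finset.sum_le_sum fun x _ =>
    mul_le_mul_of_nonneg_left (Real.exp_le_exp.mpr (hf x)) (hw x)

lemma le_log_sum_exp (hw : ∀ x, 0 ≤ w x) (hZ : 0 < ∑ x, w x) {f : Ω → ℝ} {a : ℝ}
    (hf : ∀ x, a ≤ f x) :
    Real.log (∑ x, w x) + a ≤ Real.log (∑ x, w x * Real.exp (f x)) := by
  rw [Real.le_log_iff_exp_le (sum_mul_exp_pos hw hZ f), Real.exp_add, Real.exp_log hZ,
    Finset.sum_mul]
  exact Finset.sum_le_sum fun x _ =>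
    mul_le_mul_of_nonneg_left (Real.exp_le_exp.mpr (hf x)) (hw x)

lemma exp_neg_mul_sign (b x : ℝ) (hx : x = 1 ∨ x = -1) :
    Real.exp (-b * x) = Real.cosh b * (1 - Real.tanh b * x) := by
  have hc := (Real.cosh_pos b).ne'
  rw [Real.tanh_eq_sinh_div_cosh]
  rcases hx with rfl | rfl
  · rw [mul_one, ← Real.cosh_sub_sinh]; field_simp
  · rw [neg_mul_neg, mul_one, ← Real.cosh_add_sinh]; field_simp; ring

lemma log_covariance_le (hw : ∀ x, 0 ≤ w x) (hZ : 0 < ∑ x, w x) {X Y : Ω → ℝ} {b : ℝ}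
    (hX : ∀ x, X x = 1 ∨ X x = -1) (hY : ∀ x, Y x = 1 ∨ Y x = -1)
    (hb : |Real.tanh b| ≤ 1 / 2) :
    Real.log (∑ x, w x * Real.exp (-b * (X x + Y x))) - Real.log (∑ x, w x)
      ≤ (Real.log (∑ x, w x * Real.exp (-b * X x)) - Real.log (∑ x, w x))
        + (Real.log (∑ x, w x * Real.exp (-b * Y x)) - Real.log (∑ x, w x))
        + Real.tanh b ^ 2 * (wavg w (fun x => X x * Y x) - wavg w X * wavg w Y)
        + 24 * |Real.tanh b| ^ 3 := by
  have hXY : ∀ x, |X x * Y x| ≤ 1 := fun x => by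
    rcases hX x with h | h <;> rcases hY x with h' | h' <;> simp [h, h']
  have hX1 := abs_wavg_le_one hw hZ (f := X) fun x => by
    rcases hX x with h | h <;> simp [h]
  have hY1 := abs_wavg_le_one hw hZ (f := Y) fun x => by
    rcases hY x with h | h <;> simp [h]
  have hP1 := abs_wavg_le_one hw hZ hXY
  set θ := Real.tanh b with hθ
  set Z := ∑ x, w x with hZdef
  set mX := wavg w X with hmX
  set mY := wavg w Y with hmY
  set P := wavg w (fun x => X x * Y x) with hP
  have hc := Real.cosh_pos b
  have sX : ∑ x, w x * X x = mX * Z := by rw [hmX, wavg, div_mul_cancel₀ _ hZ.ne']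
  have sY : ∑ x, w x * Y x = mY * Z := by rw [hmY, wavg, div_mul_cancel₀ _ hZ.ne']
  have sP : ∑ x, w x * (X x * Y x) = P * Z := by rw [hP, wavg, div_mul_cancel₀ _ hZ.ne']
  have eX : ∑ x, w x * Real.exp (-b * X x) = Z * (Real.cosh b * (1 - θ * mX)) := by
    have : ∀ x, w x * Real.exp (-b * X x)
      = Real.cosh b * w x - Real.cosh b * θ * (w x * X x) := fun x => by
        rw [exp_neg_mul_sign b _ (hX x)]; ring
    simp_rw [this, Finset.sum_sub_distrib, ← Finset.mul_sum, sX]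
    ring
  have eY : ∑ x, w x * Real.exp (-b * Y x) = Z * (Real.cosh b * (1 - θ * mY)) := by
    have : ∀ x, w x * Real.exp (-b * Y x)
      = Real.cosh b * w x - Real.cosh b * θ * (w x * Y x) := fun x => by
        rw [exp_neg_mul_sign b _ (hY x)]; ring
    simp_rw [this, Finset.sum_sub_distrib, ← Finset.mul_sum, sY]
    ring
  have eP : ∑ x, w x * Real.exp (-b * (X x + Y x))
      = Z * (Real.cosh b ^ 2 * (1 - θ * mX - θ * mY + θ ^ 2 * P)) := by
    have : ∀ x, w x * Real.exp (-b * (X x + Y x))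
      = Real.cosh b ^ 2 * w x - Real.cosh b ^ 2 * θ * (w x * X x)
        - Real.cosh b ^ 2 * θ * (w x * Y x)
        + Real.cosh b ^ 2 * θ ^ 2 * (w x * (X x * Y x)) := fun x => by
        rw [mul_add, Real.exp_add, exp_neg_mul_sign b _ (hX x), exp_neg_mul_sign b _ (hY x)]; ring
    simp_rw [this, Finset.sum_add_distrib, Finset.sum_sub_distrib, ← Finset.mul_sum, sX, sY, sP]
    ring
  have pX : |θ * mX| ≤ |θ| := by
    rw [abs_mul]; exact mul_le_of_le_one_right (abs_nonneg _) hX1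
  have pY : |θ * mY| ≤ |θ| := by
    rw [abs_mul]; exact mul_le_of_le_one_right (abs_nonneg _) hY1
  have dX : 1 / 2 ≤ 1 - θ * mX := by linarith [(abs_le.mp pX).2]
  have dY : 1 / 2 ≤ 1 - θ * mY := by linarith [(abs_le.mp pY).2]
  have hD : 1 / 4 ≤ (1 - θ * mX) * (1 - θ * mY) := by nlinarith
  set D := (1 - θ * mX) * (1 - θ * mY) with hDdef
  have hD0 : 0 < D := by linarith
  set c := P - mX * mY with hcdef
  have hcb : |c| ≤ 2 := by
    have h1 : |mX * mY| ≤ 1 := by rw [abs_mul]; exact mul_le_one₀ hX1 (abs_nonneg _) hY1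
    linarith [abs_sub P (mX * mY)]
  have hpos : 0 < 1 - θ * mX - θ * mY + θ ^ 2 * P := by
    have := sum_mul_exp_pos hw hZ fun x => -b * (X x + Y x)
    rw [eP] at this
    have h2 := (mul_pos_iff_of_pos_left hZ).mp this
    exact (mul_pos_iff_of_pos_left (by positivity)).mp h2
  have hr : 1 - θ * mX - θ * mY + θ ^ 2 * P = D * (1 + θ ^ 2 * c / D) := by
    rw [mul_add, mul_div_cancel₀ _ hD0.ne']; rw [hDdef, hcdef]; ring
  have hrat : 0 < 1 + θ ^ 2 * c / D := by
    rw [hr] at hpos; exact (mul_pos_iff_of_pos_left hD0).mp hpos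
  have lX : Real.log (∑ x, w x * Real.exp (-b * X x))
      = Real.log Z + (Real.log (Real.cosh b) + Real.log (1 - θ * mX)) := by
    rw [eX, Real.log_mul hZ.ne' (by positivity), Real.log_mul hc.ne' (by positivity)]
  have lY : Real.log (∑ x, w x * Real.exp (-b * Y x))
      = Real.log Z + (Real.log (Real.cosh b) + Real.log (1 - θ * mY)) := by
    rw [eY, Real.log_mul hZ.ne' (by positivity), Real.log_mul hc.ne' (by positivity)]
  have lP : Real.log (∑ x, w x * Real.exp (-b * (X x + Y x)))
      = Real.log Z + (2 * Real.log (Real.cosh b) + (Real.log (1 - θ * mX) + Real.log (1 - θ * mY)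
        + Real.log (1 + θ ^ 2 * c / D))) := by
    rw [eP, hr, Real.log_mul hZ.ne' (by positivity), Real.log_mul (by positivity) (by positivity),
      Real.log_mul hD0.ne' hrat.ne', hDdef, Real.log_mul (by positivity) (by positivity),
      Real.log_pow]
    norm_num
  rw [lX, lY, lP]
  have hlog := Real.log_le_sub_one_of_pos hrat
  have herr : θ ^ 2 * c / D ≤ θ ^ 2 * c + 24 * |θ| ^ 3 := by
    have e : θ ^ 2 * c / D - θ ^ 2 * c = θ ^ 2 * (c * (1 - D)) / D := by
      field_simp
    have h1 : |1 - D| ≤ 5 / 2 * |θ| := by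
      have : 1 - D = θ * mX + θ * mY - θ * mX * (θ * mY) := by rw [hDdef]; ring
      rw [this]
      have h3 : |θ * mX * (θ * mY)| ≤ |θ| * |θ| := by
        rw [abs_mul]; exact mul_le_mul pX pY (abs_nonneg _) (abs_nonneg _)
      have h4 : |θ| * |θ| ≤ 1 / 2 * |θ| := mul_le_mul_of_nonneg_right hb (abs_nonneg _)
      linarith [abs_sub (θ * mX + θ * mY) (θ * mX * (θ * mY)), abs_add_le (θ * mX) (θ * mY)]
    have h2 : c * (1 - D) ≤ 5 * |θ| := by
      calc c * (1 - D) ≤ |c| * |1 - D| := by rw [← abs_mul]; exact le_abs_self _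
        _ ≤ 2 * (5 / 2 * |θ|) := mul_le_mul hcb h1 (abs_nonneg _) (by norm_num)
        _ = _ := by ring
    have h3 : θ ^ 2 * (c * (1 - D)) / D ≤ 24 * |θ| ^ 3 := by
      rw [div_le_iff₀ hD0]
      have h5 : θ ^ 2 * (c * (1 - D)) ≤ θ ^ 2 * (5 * |θ|) :=
        mul_le_mul_of_nonneg_left h2 (sq_nonneg _)
      have h6 : θ ^ 2 * (5 * |θ|) = 5 * |θ| ^ 3 := by rw [← sq_abs]; ring
      have h7 : 24 * |θ| ^ 3 * (1 / 4) ≤ 24 * |θ| ^ 3 * D :=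
        mul_le_mul_of_nonneg_left hD (by positivity)
      have : 0 ≤ |θ| ^ 3 := by positivity
      linarith
    linarith
  linarith

end weighted

lemma abs_spin (b : Bool) : |spin b| = 1 := by cases b <;> simp [spin]

lemma spin_mul_eq (b c : Bool) : spin b * spin c = 1 ∨ spin b * spin c = -1 := by
  cases b <;> cases c <;> simp [spin]

open scoped Classical in
/-- The indicator of the set of bisections. -/
noncomputable def bisInd {n : ℕ} (σ : Fin n → Bool) : ℝ := if isBis σ then 1 else 0

lemma bisInd_nonneg {n : ℕ} (σ : Fin n → Bool) : 0 ≤ bisInd σ := by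
  unfold bisInd; split_ifs <;> norm_num

/-- The number of bisections. -/
noncomputable def bisCount (n : ℕ) : ℝ := ∑ σ : Fin n → Bool, bisInd σ

lemma isBis_of_card {n : ℕ} {S : Finset (Fin n)} (hS : S.card = n / 2) :
    isBis fun i => decide (i ∈ S) := by
  have h : ∑ i, spin (decide (i ∈ S)) = 2 * (S.card : ℝ) - n := by
    have : ∀ i, spin (decide (i ∈ S)) = 2 * (if i ∈ S then (1 : ℝ) else 0) - 1 := fun i => by
      by_cases hi : i ∈ S <;> simp [spin, hi]; norm_num
    simp_rw [this, Finset.sum_sub_distrib, ← Finset.mul_sum]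
    simp
  unfold isBis
  rw [h, hS]
  have h1 : 2 * (n / 2) ≤ n := by omega
  have h2 : n ≤ 2 * (n / 2) + 1 := by omega
  have h1' : (2 : ℝ) * ((n / 2 : ℕ) : ℝ) ≤ n := by exact_mod_cast h1
  have h2' : (n : ℝ) ≤ 2 * ((n / 2 : ℕ) : ℝ) + 1 := by exact_mod_cast h2
  rw [abs_le]
  constructor <;> linarith

lemma choose_le_bisCount (n : ℕ) : ((n.choose (n / 2) : ℕ) : ℝ) ≤ bisCount n := by
  classical
  have hc : bisCount n = ((Finset.univ.filter fun σ : Fin n → Bool => isBis σ).card : ℝ) := by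
    simp [bisCount, bisInd, Finset.sum_boole]
  rw [hc, Nat.cast_le]
  have := Finset.card_powersetCard (n / 2) (Finset.univ : Finset (Fin n))
  rw [Finset.card_univ, Fintype.card_fin] at this
  rw [← this]
  refine Finset.card_le_card_of_injOn (fun S i => decide (i ∈ S)) (fun S hS => ?_)
    (fun S _ T _ h => ?_)
  · simp only [Finset.coe_filter, Finset.mem_univ, true_and, Set.mem_ofPred_eq]
    exact isBis_of_card (Finset.mem_powersetCard.mp hS).2
  · ext i
    simpa using congrFun h i

lemma two_pow_le_bisCount (n : ℕ) : (2 : ℝ) ^ n ≤ (n + 1) * bisCount n := by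
  have h : 2 ^ n ≤ (n + 1) * n.choose (n / 2) := by
    rw [← Nat.sum_range_choose]
    refine (Finset.sum_le_sum fun m _ => Nat.choose_le_middle m n).trans ?_
    simp
  calc (2 : ℝ) ^ n ≤ (n + 1) * (n.choose (n / 2) : ℕ) := by exact_mod_cast h
    _ ≤ _ := mul_le_mul_of_nonneg_left (choose_le_bisCount n) (by positivity)

lemma bisCount_pos (n : ℕ) : 0 < bisCount n := by
  have h := two_pow_le_bisCount n
  have : (0 : ℝ) < 2 ^ n := by positivity
  exact pos_of_mul_pos_right (this.trans_le h) (by positivity)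

lemma ham_add {n : ℕ} (N N' : CountMat n) (σ : Fin n → Bool) :
    Ham (natMat (N + N')) σ = Ham (natMat N) σ + Ham (natMat N') σ := by
  simp [Ham, natMat, add_mul, Finset.sum_add_distrib]

lemma ham_zero {n : ℕ} (σ : Fin n → Bool) : Ham (natMat (0 : CountMat n)) σ = 0 := by
  simp [Ham, natMat]

lemma ham_unitMat {n : ℕ} (i j : Fin n) (σ : Fin n → Bool) :
    Ham (natMat (unitMat i j)) σ = spin (σ i) * spin (σ j) := by
  unfold Ham natMat
  simp_rw [mul_assoc]
  exact sum_unitMat_mul i j fun k l => spin (σ k) * spin (σ l)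

lemma abs_ham_le {n : ℕ} (N : CountMat n) (σ : Fin n → Bool) :
    |Ham (natMat N) σ| ≤ total N := by
  rw [cast_total]
  refine (Finset.abs_sum_le_sum_abs _ _).trans (Finset.sum_le_sum fun i _ => ?_)
  refine (Finset.abs_sum_le_sum_abs _ _).trans (Finset.sum_le_sum fun j _ => ?_)
  simp [natMat, abs_mul, abs_spin]

lemma sq_mul_overlap_sq {n : ℕ} (σ τ : Fin n → Bool) :
    (n : ℝ) ^ 2 * overlap σ τ ^ 2 = (∑ i, spin (σ i) * spin (τ i)) ^ 2 := by
  rcases Nat.eq_zero_or_pos n with rfl | hn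
  · simp
  · have : (n : ℝ) ≠ 0 := by positivity
    unfold overlap; field_simp

lemma sq_mul_overlap_sq_eq_sum {n : ℕ} (σ τ : Fin n → Bool) :
    (n : ℝ) ^ 2 * overlap σ τ ^ 2
      = ∑ i, ∑ j, (spin (σ i) * spin (σ j)) * (spin (τ i) * spin (τ j)) := by
  rw [sq_mul_overlap_sq, sq, Finset.sum_mul_sum]
  exact Finset.sum_congr rfl fun i _ => Finset.sum_congr rfl fun j _ => by ring

lemma overlap_sq_le_one {n : ℕ} (σ τ : Fin n → Bool) : overlap σ τ ^ 2 ≤ 1 := by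
  rcases Nat.eq_zero_or_pos n with rfl | hn
  · simp [overlap]
  · have h := sq_mul_overlap_sq σ τ
    have h1 : |∑ i, spin (σ i) * spin (τ i)| ≤ n := by
      refine (Finset.abs_sum_le_sum_abs _ _).trans ?_
      simp [abs_mul, abs_spin]
    have h2 : (∑ i, spin (σ i) * spin (τ i)) ^ 2 ≤ (n : ℝ) ^ 2 := by
      rw [← sq_abs]; gcongr
    have h3 : (0 : ℝ) < (n : ℝ) ^ 2 := by positivity
    rw [← h] at h2
    nlinarith

/-- The Boltzmann weight of a pair of bisections with a quadratic overlap coupling `s`. -/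
noncomputable def pairWeight {n : ℕ} (b s : ℝ) (p : CountMat n × CountMat n)
    (x : (Fin n → Bool) × (Fin n → Bool)) : ℝ :=
  bisInd x.1 * bisInd x.2 * Real.exp (-b * (Ham (natMat p.1) x.1 + Ham (natMat p.2) x.2)
    + s * (n * overlap x.1 x.2 ^ 2))

/-- The free energy of a pair of bisections with a quadratic overlap coupling `s`. -/
noncomputable def pairFree {n : ℕ} (b s : ℝ) (p : CountMat n × CountMat n) : ℝ :=
  Real.log (∑ x, pairWeight b s p x)

section pairFree
variable {n : ℕ} (b s : ℝ) (p q : CountMat n × CountMat n)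

lemma pairWeight_nonneg (x) : 0 ≤ pairWeight b s p x :=
  mul_nonneg (mul_nonneg (bisInd_nonneg _) (bisInd_nonneg _)) (Real.exp_pos _).le

lemma sum_pairWeight_pos : 0 < ∑ x, pairWeight b s p x := by
  refine sum_mul_exp_pos (w := fun x : (Fin n → Bool) × (Fin n → Bool) => bisInd x.1 * bisInd x.2)
    (fun x => mul_nonneg (bisInd_nonneg _) (bisInd_nonneg _)) ?_ _
  rw [Fintype.sum_prod_type]
  simp_rw [← Finset.mul_sum, ← Finset.sum_mul]
  exact mul_pos (bisCount_pos n) (bisCount_pos n)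

lemma pairWeight_add (x) : pairWeight b s (p + q) x
    = pairWeight b s p x * Real.exp (-b * (Ham (natMat q.1) x.1 + Ham (natMat q.2) x.2)) := by
  unfold pairWeight
  rw [mul_assoc (bisInd x.1 * bisInd x.2), ← Real.exp_add, Prod.fst_add, Prod.snd_add, ham_add,
    ham_add]
  ring_nf

lemma pairWeight_coupling_add (δ : ℝ) (x) : pairWeight b (s + δ) p x
    = pairWeight b s p x * Real.exp (δ * (n * overlap x.1 x.2 ^ 2)) := by
  unfold pairWeight
  rw [mul_assoc (bisInd x.1 * bisInd x.2), ← Real.exp_add]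
  ring_nf

lemma pairFree_add : pairFree b s (p + q) = Real.log (∑ x, pairWeight b s p x *
    Real.exp (-b * (Ham (natMat q.1) x.1 + Ham (natMat q.2) x.2))) := by
  simp_rw [pairFree, pairWeight_add]

lemma lipPair_pairFree : LipPair |b| (pairFree (n := n) b s) := fun p q => by
  have hb : ∀ x : (Fin n → Bool) × (Fin n → Bool),
      |-b * (Ham (natMat q.1) x.1 + Ham (natMat q.2) x.2)|
        ≤ |b| * (total q.1 + total q.2) := fun x => by
    rw [abs_mul, abs_neg]
    refine mul_le_mul_of_nonneg_left ((abs_add_le _ _).trans ?_) (abs_nonneg _)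
    exact add_le_add (abs_ham_le _ _) (abs_ham_le _ _)
  have h1 := log_sum_exp_le (pairWeight_nonneg b s p) (sum_pairWeight_pos b s p)
    fun x => (abs_le.mp (hb x)).2
  have h2 := le_log_sum_exp (pairWeight_nonneg b s p) (sum_pairWeight_pos b s p)
    fun x => (abs_le.mp (hb x)).1
  rw [pairFree_add, abs_le]
  constructor
  · linarith [show pairFree b s p = Real.log (∑ x, pairWeight b s p x) from rfl]
  · linarith [show pairFree b s p = Real.log (∑ x, pairWeight b s p x) from rfl]

lemma pairFree_coupling_le {δ : ℝ} (hδ : 0 ≤ δ) :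
    pairFree b (s + δ) p ≤ pairFree b s p + δ * n := by
  have h := log_sum_exp_le (pairWeight_nonneg b s p) (sum_pairWeight_pos b s p)
    (f := fun x => δ * (n * overlap x.1 x.2 ^ 2)) (a := δ * n) fun x =>
      mul_le_mul_of_nonneg_left
        (mul_le_of_le_one_right (Nat.cast_nonneg _) (overlap_sq_le_one _ _)) hδ
  simp_rw [← pairWeight_coupling_add] at h
  exact h

lemma le_pairFree_coupling (δ : ℝ) :
    pairFree b s p + δ * (n * wavg (pairWeight b s p) fun x => overlap x.1 x.2 ^ 2)
      ≤ pairFree b (s + δ) p := by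
  have h := log_sum_add_wavg_le (pairWeight_nonneg b s p) (sum_pairWeight_pos b s p)
    fun x => δ * (n * overlap x.1 x.2 ^ 2)
  simp_rw [← pairWeight_coupling_add] at h
  rw [wavg_const_mul, wavg_const_mul] at h
  exact h

lemma pairFree_le_coupling {δ : ℝ} (hδ : 0 ≤ δ) : pairFree b s p ≤ pairFree b (s + δ) p := by
  refine le_trans ?_ (le_pairFree_coupling b s p δ)
  have := wavg_nonneg (pairWeight_nonneg b s p) (f := fun x => overlap x.1 x.2 ^ 2)
    fun x => sq_nonneg _
  exact le_add_of_nonneg_right (by positivity)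

lemma sum_wavg_mul_wavg_nonneg {Ω ι : Type*} [Fintype Ω] [Fintype ι] {w : Ω → ℝ}
    (hw : ∀ x, 0 ≤ w x) (U V : ι → Ω → ℝ) :
    0 ≤ ∑ i, ∑ j, wavg w (fun x => U i x * U j x) * wavg w (fun x => V i x * V j x) := by
  have e : ∑ i, ∑ j, wavg w (fun x => U i x * U j x) * wavg w (fun x => V i x * V j x)
      = (∑ x, ∑ y, w x * w y * (∑ i, U i x * V i y) ^ 2) / ((∑ x, w x) * ∑ x, w x) := by
    simp_rw [wavg, div_mul_div_comm, ← Finset.sum_div, Finset.sum_mul_sum, sq, Finset.sum_mul_sum,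
      Finset.mul_sum]
    congr 1
    calc _ = ∑ i, ∑ x, ∑ j, ∑ y, w x * (U i x * U j x) * (w y * (V i y * V j y)) :=
          Finset.sum_congr rfl fun i _ => Finset.sum_comm
      _ = ∑ x, ∑ i, ∑ j, ∑ y, w x * (U i x * U j x) * (w y * (V i y * V j y)) :=
          Finset.sum_comm
      _ = ∑ x, ∑ y, ∑ i, ∑ j, w x * (U i x * U j x) * (w y * (V i y * V j y)) := by
          refine Finset.sum_congr rfl fun x _ => ?_
          rw [Finset.sum_comm]
          conv_rhs => rw [Finset.sum_comm]
          rw [Finset.sum_comm]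
          exact Finset.sum_congr rfl fun i _ => Finset.sum_comm
      _ = _ := by
          refine Finset.sum_congr rfl fun x _ => Finset.sum_congr rfl fun y _ =>
            Finset.sum_congr rfl fun i _ => Finset.sum_congr rfl fun j _ => ?_
          ring
  rw [e]
  refine div_nonneg (Finset.sum_nonneg fun x _ => Finset.sum_nonneg fun y _ => ?_)
    (mul_self_nonneg _)
  exact mul_nonneg (mul_nonneg (hw x) (hw y)) (sq_nonneg _)

lemma pairFree_shared_point_le (hb : |Real.tanh b| ≤ 1 / 2) (i j : Fin n) :
    pairFree b s (p + (unitMat i j, unitMat i j)) - pairFree b s p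
      ≤ (pairFree b s (p + (unitMat i j, 0)) - pairFree b s p)
        + (pairFree b s (p + (0, unitMat i j)) - pairFree b s p)
        + Real.tanh b ^ 2 *
          (wavg (pairWeight b s p) (fun x => (spin (x.1 i) * spin (x.1 j))
              * (spin (x.2 i) * spin (x.2 j)))
            - wavg (pairWeight b s p) (fun x => spin (x.1 i) * spin (x.1 j))
              * wavg (pairWeight b s p) (fun x => spin (x.2 i) * spin (x.2 j)))
        + 24 * |Real.tanh b| ^ 3 := by
  have h := log_covariance_le (pairWeight_nonneg b s p) (sum_pairWeight_pos b s p)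
    (X := fun x => spin (x.1 i) * spin (x.1 j)) (Y := fun x => spin (x.2 i) * spin (x.2 j))
    (fun x => spin_mul_eq _ _) (fun x => spin_mul_eq _ _) hb
  simp only [pairFree_add, ham_unitMat, ham_zero, add_zero, zero_add]
  exact h

lemma sum_wavg_spin_eq : ∑ i, ∑ j, wavg (pairWeight b s p)
      (fun x => (spin (x.1 i) * spin (x.1 j)) * (spin (x.2 i) * spin (x.2 j)))
    = (n : ℝ) ^ 2 * wavg (pairWeight b s p) fun x => overlap x.1 x.2 ^ 2 := by
  rw [← wavg_const_mul]
  simp_rw [sq_mul_overlap_sq_eq_sum, wavg_sum]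

lemma pairFree_step (hb : |Real.tanh b| ≤ 1 / 2) (r : ℝ≥0) :
    pairFree b s p + r * ∑ i, ∑ j, (pairFree b s (p + (unitMat i j, unitMat i j)) - pairFree b s p)
      ≤ pairFree b (s + r * (n * Real.tanh b ^ 2)) p
        + r * ∑ i, ∑ j, (pairFree b (s + r * (n * Real.tanh b ^ 2)) (p + (unitMat i j, 0))
          - pairFree b (s + r * (n * Real.tanh b ^ 2)) p)
        + r * ∑ i, ∑ j, (pairFree b (s + r * (n * Real.tanh b ^ 2)) (p + (0, unitMat i j))
          - pairFree b (s + r * (n * Real.tanh b ^ 2)) p)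
        + (r * (n ^ 2 * (24 * |Real.tanh b| ^ 3))
          + r ^ 2 * (2 * n ^ 4 * Real.tanh b ^ 2)) := by
  set θ := Real.tanh b with hθ
  set δ : ℝ := r * (n * θ ^ 2) with hδ
  have hδ0 : 0 ≤ δ := by positivity
  set ρ := wavg (pairWeight b s p) fun x => overlap x.1 x.2 ^ 2 with hρ
  have hmono (q : CountMat n × CountMat n) : pairFree b s (p + q) - pairFree b s p
      ≤ pairFree b (s + δ) (p + q) - pairFree b (s + δ) p + δ * n := by
    linarith [pairFree_coupling_le b s p hδ0, pairFree_le_coupling b s (p + q) hδ0]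
  have hsum : ∑ i, ∑ j, (pairFree b s (p + (unitMat i j, unitMat i j)) - pairFree b s p)
      ≤ ∑ i, ∑ j, (pairFree b (s + δ) (p + (unitMat i j, 0)) - pairFree b (s + δ) p)
        + ∑ i, ∑ j, (pairFree b (s + δ) (p + (0, unitMat i j)) - pairFree b (s + δ) p)
        + θ ^ 2 * (n ^ 2 * ρ) + n ^ 2 * (2 * (δ * n) + 24 * |θ| ^ 3) := by
    have hcorr := sum_wavg_mul_wavg_nonneg (pairWeight_nonneg b s p)
      (fun (i : Fin n) x => spin (x.1 i)) (fun (i : Fin n) x => spin (x.2 i))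
    have hle : ∑ i, ∑ j, (pairFree b s (p + (unitMat i j, unitMat i j)) - pairFree b s p)
        ≤ ∑ i : Fin n, ∑ j : Fin n,
          ((pairFree b (s + δ) (p + (unitMat i j, 0)) - pairFree b (s + δ) p)
          + (pairFree b (s + δ) (p + (0, unitMat i j)) - pairFree b (s + δ) p)
          + θ ^ 2 * (wavg (pairWeight b s p) (fun x => (spin (x.1 i) * spin (x.1 j))
              * (spin (x.2 i) * spin (x.2 j)))
            - wavg (pairWeight b s p) (fun x => spin (x.1 i) * spin (x.1 j))
              * wavg (pairWeight b s p) (fun x => spin (x.2 i) * spin (x.2 j)))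
          + (2 * (δ * n) + 24 * |θ| ^ 3)) :=
      Finset.sum_le_sum fun i _ => Finset.sum_le_sum fun j _ => by
        linarith [pairFree_shared_point_le b s p hb i j, hmono (unitMat i j, 0),
          hmono (0, unitMat i j)]
    refine hle.trans ?_
    have e := sum_wavg_spin_eq b s p
    have ec : ∑ i : Fin n, ∑ j : Fin n, (2 * (δ * n) + 24 * |θ| ^ 3)
        = n ^ 2 * (2 * (δ * n) + 24 * |θ| ^ 3) := by simp; ring
    rw [← hρ] at e
    rw [← e, ← ec]
    simp only [Finset.sum_add_distrib, ← Finset.mul_sum, Finset.sum_sub_distrib] at hcorr ⊢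
    have := mul_nonneg (sq_nonneg θ) hcorr
    linarith
  have h1 := mul_le_mul_of_nonneg_left hsum r.coe_nonneg
  have h2 := le_pairFree_coupling b s p δ
  rw [← hρ] at h2
  have h3 : δ * (n * ρ) = r * (θ ^ 2 * (n ^ 2 * ρ)) := by rw [hδ]; ring
  have h4 : (r : ℝ) * (n ^ 2 * (2 * (δ * n) + 24 * |θ| ^ 3))
    = r * (n ^ 2 * (24 * |θ| ^ 3)) + r ^ 2 * (2 * n ^ 4 * θ ^ 2) := by rw [hδ]; ring
  linarith

end pairFree

/-- Shared randomness may be traded for independent randomness and a larger overlap coupling. -/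
lemma integral_pairFree_step {n : ℕ} {b : ℝ} (hb : |Real.tanh b| ≤ 1 / 2) (r : ℝ≥0) (k : ℕ) :
    ∀ (s : ℝ) (u : ℝ≥0), ∫ p, pairFree b s p ∂(pairLaw n (k * r) u u)
      ≤ ∫ p, pairFree b (s + k * r * (n * Real.tanh b ^ 2)) p
          ∂(pairLaw n 0 (u + k * r) (u + k * r))
        + k * (r * (n ^ 2 * (24 * |Real.tanh b| ^ 3))
          + r ^ 2 * (2 * n ^ 4 * Real.tanh b ^ 2 + 10 * |b| * n ^ 4)) := by
  induction k with
  | zero => intro s u; simp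
  | succ k ih =>
    intro s u
    have h1 := (lipPair_pairFree (n := n) b s).integral_step_le
      (lipPair_pairFree b (s + r * (n * Real.tanh b ^ 2))) (k * r) u r
      (fun p => pairFree_step b s p hb r)
    have h2 := ih (s + r * (n * Real.tanh b ^ 2)) (u + r)
    have e1 : ((k + 1 : ℕ) : ℝ≥0) * r = k * r + r := by push_cast; ring
    have e2 : u + (k * r + r) = u + r + k * r := by ring
    have e3 : s + ((k + 1 : ℕ) : ℝ) * r * (n * Real.tanh b ^ 2)
      = s + r * (n * Real.tanh b ^ 2) + k * r * (n * Real.tanh b ^ 2) := by push_cast; ring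
    rw [e1, e2, e3]
    push_cast
    linarith

lemma integral_pairFree_le {n : ℕ} {b : ℝ} (hb : |Real.tanh b| ≤ 1 / 2) (s : ℝ) (a u : ℝ≥0) :
    ∫ p, pairFree b s p ∂(pairLaw n a u u)
      ≤ ∫ p, pairFree b (s + a * (n * Real.tanh b ^ 2)) p ∂(pairLaw n 0 (u + a) (u + a))
        + a * (n ^ 2 * (24 * |Real.tanh b| ^ 3)) := by
  set K : ℝ := 2 * n ^ 4 * Real.tanh b ^ 2 + 10 * |b| * n ^ 4 with hK
  have hlim : Tendsto (fun k : ℕ =>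
      (∫ p, pairFree b (s + a * (n * Real.tanh b ^ 2)) p ∂(pairLaw n 0 (u + a) (u + a))
        + a * (n ^ 2 * (24 * |Real.tanh b| ^ 3))) + a ^ 2 * K / (k : ℝ)) atTop
      (nhds ((∫ p, pairFree b (s + a * (n * Real.tanh b ^ 2)) p ∂(pairLaw n 0 (u + a) (u + a))
        + a * (n ^ 2 * (24 * |Real.tanh b| ^ 3))) + 0)) :=
    tendsto_const_nhds.add (tendsto_const_div_atTop_nhds_zero_nat _)
  rw [add_zero] at hlim
  refine ge_of_tendsto hlim ?_
  filter_upwards [eventually_gt_atTop 0] with k hk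
  have hk' : (k : ℝ≥0) ≠ 0 := by positivity
  have hkr : (k : ℝ) ≠ 0 := by positivity
  have h := integral_pairFree_step (n := n) hb (a / k) k s u
  have e : (k : ℝ≥0) * (a / k) = a := mul_div_cancel₀ _ hk'
  have e' : (k : ℝ) * ((a / k : ℝ≥0) : ℝ) = a := by
    push_cast; exact mul_div_cancel₀ _ hkr
  rw [e, e', ← hK] at h
  refine h.trans (le_of_eq ?_)
  have : (k : ℝ) * (((a / k : ℝ≥0) : ℝ) * (n ^ 2 * (24 * |Real.tanh b| ^ 3))
      + ((a / k : ℝ≥0) : ℝ) ^ 2 * K)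
    = a * (n ^ 2 * (24 * |Real.tanh b| ^ 3)) + a ^ 2 * K / k := by
    push_cast; field_simp
  rw [this, add_assoc]

section gibbsBis
variable {n : ℕ} (b : ℝ)

lemma zpartBis_eq (X : Fin n → Fin n → ℝ) :
    ZpartBis b X = ∑ σ, bisInd σ * Real.exp (-b * Ham X σ) := by
  unfold ZpartBis bisInd
  exact Finset.sum_congr rfl fun σ _ => by split_ifs <;> simp

lemma zpartBis_pos (X : Fin n → Fin n → ℝ) : 0 < ZpartBis b X := by
  rw [zpartBis_eq]
  exact sum_mul_exp_pos bisInd_nonneg (bisCount_pos n) _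

lemma gibbsBis_eq (X : Fin n → Fin n → ℝ) (σ : Fin n → Bool) :
    gibbsBis b X σ = bisInd σ * Real.exp (-b * Ham X σ) / ZpartBis b X := by
  unfold gibbsBis bisInd
  split_ifs <;> simp

lemma gibbsBis_nonneg (X : Fin n → Fin n → ℝ) (σ : Fin n → Bool) : 0 ≤ gibbsBis b X σ := by
  rw [gibbsBis_eq]
  exact div_nonneg (mul_nonneg (bisInd_nonneg _) (Real.exp_pos _).le) (zpartBis_pos b X).le

lemma sum_gibbsBis (X : Fin n → Fin n → ℝ) : ∑ σ, gibbsBis b X σ = 1 := by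
  simp_rw [gibbsBis_eq]
  rw [← Finset.sum_div, ← zpartBis_eq, div_self (zpartBis_pos b X).ne']

lemma gibbsBis_le_one (X : Fin n → Fin n → ℝ) (σ : Fin n → Bool) : gibbsBis b X σ ≤ 1 := by
  rw [← sum_gibbsBis b X]
  exact Finset.single_le_sum (fun τ _ => gibbsBis_nonneg b X τ) (Finset.mem_univ σ)

variable (p : CountMat n × CountMat n)

lemma pairWeight_eq (s : ℝ) (x) : pairWeight b s p x
    = ZpartBis b (natMat p.1) * ZpartBis b (natMat p.2) *
      (gibbsBis b (natMat p.1) x.1 * gibbsBis b (natMat p.2) x.2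
        * Real.exp (s * (n * overlap x.1 x.2 ^ 2))) := by
  have h1 := (zpartBis_pos b (natMat p.1)).ne'
  have h2 := (zpartBis_pos b (natMat p.2)).ne'
  rw [gibbsBis_eq, gibbsBis_eq, pairWeight, mul_add, Real.exp_add, Real.exp_add]
  field_simp

lemma pairFree_eq (s : ℝ) : pairFree b s p
    = Real.log (ZpartBis b (natMat p.1)) + Real.log (ZpartBis b (natMat p.2))
      + Real.log (∑ σ, ∑ τ, gibbsBis b (natMat p.1) σ * gibbsBis b (natMat p.2) τ
        * Real.exp (s * (n * overlap σ τ ^ 2))) := by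
  have h1 := zpartBis_pos b (natMat p.1)
  have h2 := zpartBis_pos b (natMat p.2)
  have h3 := sum_pairWeight_pos b s p
  have e : ∑ x, pairWeight b s p x = ZpartBis b (natMat p.1) * ZpartBis b (natMat p.2) *
      ∑ σ, ∑ τ, gibbsBis b (natMat p.1) σ * gibbsBis b (natMat p.2) τ
        * Real.exp (s * (n * overlap σ τ ^ 2)) := by
    simp_rw [pairWeight_eq, ← Finset.mul_sum, Fintype.sum_prod_type]
  rw [pairFree, e]
  rw [e] at h3
  rw [Real.log_mul (mul_pos h1 h2).ne' (pos_of_mul_pos_right h3 (mul_pos h1 h2).le).ne',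
    Real.log_mul h1.ne' h2.ne']

lemma sum_gibbsBis_mul (q : CountMat n × CountMat n) :
    ∑ σ, ∑ τ, gibbsBis b (natMat q.1) σ * gibbsBis b (natMat q.2) τ = 1 := by
  simp_rw [← Finset.mul_sum, sum_gibbsBis, mul_one, sum_gibbsBis]

lemma pairFree_zero_coupling : pairFree b 0 p
    = Real.log (ZpartBis b (natMat p.1)) + Real.log (ZpartBis b (natMat p.2)) := by
  rw [pairFree_eq]
  simp only [zero_mul, Real.exp_zero, mul_one, sum_gibbsBis_mul, Real.log_one, add_zero]

lemma avg2cBis_eq_wavg (f : (Fin n → Bool) → (Fin n → Bool) → ℝ) :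
    avg2cBis b (natMat p.1) (natMat p.2) f = wavg (pairWeight b 0 p) fun x => f x.1 x.2 := by
  have h := (mul_pos (zpartBis_pos b (natMat p.1)) (zpartBis_pos b (natMat p.2))).ne'
  have e : ∑ x, pairWeight b 0 p x = ZpartBis b (natMat p.1) * ZpartBis b (natMat p.2) := by
    simp_rw [pairWeight_eq, ← Finset.mul_sum, Fintype.sum_prod_type]
    simp only [zero_mul, Real.exp_zero, mul_one, sum_gibbsBis_mul]
  rw [wavg, e, eq_div_iff h, avg2cBis, Fintype.sum_prod_type, Finset.sum_mul]
  refine Finset.sum_congr rfl fun σ _ => ?_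
  rw [Finset.sum_mul]
  refine Finset.sum_congr rfl fun τ _ => ?_
  rw [pairWeight_eq]
  simp only [zero_mul, Real.exp_zero]
  ring

end gibbsBis

/-- The annealed coupled second moment of the overlap. -/
noncomputable def overlapMean (n : ℕ) (b : ℝ) (a u : ℝ≥0) : ℝ :=
  ∫ p, avg2cBis b (natMat p.1) (natMat p.2) (fun σ τ => overlap σ τ ^ 2) ∂(pairLaw n a u u)

lemma avg2cBis_overlap_nonneg {n : ℕ} (b : ℝ) (p : CountMat n × CountMat n) :
    0 ≤ avg2cBis b (natMat p.1) (natMat p.2) (fun σ τ => overlap σ τ ^ 2) := by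
  rw [avg2cBis_eq_wavg]
  exact wavg_nonneg (pairWeight_nonneg b 0 p) fun x => sq_nonneg _

lemma avg2cBis_overlap_le_one {n : ℕ} (b : ℝ) (p : CountMat n × CountMat n) :
    avg2cBis b (natMat p.1) (natMat p.2) (fun σ τ => overlap σ τ ^ 2) ≤ 1 := by
  rw [avg2cBis_eq_wavg]
  refine (le_abs_self _).trans (abs_wavg_le_one (pairWeight_nonneg b 0 p)
    (sum_pairWeight_pos b 0 p) fun x => ?_)
  rw [abs_of_nonneg (sq_nonneg _)]
  exact overlap_sq_le_one _ _

lemma integrable_avg2cBis_overlap {n : ℕ} (b : ℝ) (μ : Measure (CountMat n × CountMat n))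
    [IsFiniteMeasure μ] :
    Integrable (fun p : CountMat n × CountMat n =>
      avg2cBis b (natMat p.1) (natMat p.2) (fun σ τ => overlap σ τ ^ 2)) μ :=
  Integrable.of_bound .of_discrete 1 (Eventually.of_forall fun p => by
    rw [Real.norm_eq_abs, abs_of_nonneg (avg2cBis_overlap_nonneg b p)]
    exact avg2cBis_overlap_le_one b p)

lemma overlapMean_nonneg (n : ℕ) (b : ℝ) (a u : ℝ≥0) : 0 ≤ overlapMean n b a u :=
  integral_nonneg fun p => avg2cBis_overlap_nonneg b p

lemma overlapMean_le_one (n : ℕ) (b : ℝ) (a u : ℝ≥0) : overlapMean n b a u ≤ 1 := by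
  have := integral_mono (integrable_avg2cBis_overlap b (pairLaw n a u u)) (integrable_const 1)
    fun p => avg2cBis_overlap_le_one b p
  simpa [overlapMean] using this

lemma mul_overlapMean_le {n : ℕ} (b s : ℝ) (a u : ℝ≥0) :
    s * (n * overlapMean n b a u)
      ≤ ∫ p, pairFree b s p ∂(pairLaw n a u u) - ∫ p, pairFree b 0 p ∂(pairLaw n a u u) := by
  have hs := (lipPair_pairFree (n := n) b s).integrable a u u
  have h0 := (lipPair_pairFree (n := n) b 0).integrable a u u
  rw [← integral_sub hs h0, overlapMean, ← integral_const_mul, ← integral_const_mul]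
  refine integral_mono (((integrable_avg2cBis_overlap b _).const_mul _).const_mul _)
    (hs.sub h0) fun p => ?_
  have := le_pairFree_coupling b 0 p s
  rw [zero_add] at this
  simp only [avg2cBis_eq_wavg]
  linarith

lemma abs_log_zpartBis_sub_le {n : ℕ} (b : ℝ) (N : CountMat n) :
    |Real.log (ZpartBis b (natMat N)) - Real.log (ZpartBis b (natMat (0 : CountMat n)))|
      ≤ |b| * total N := by
  have h := lipPair_pairFree (n := n) b 0 0 (N, 0)
  rw [zero_add, pairFree_zero_coupling, pairFree_zero_coupling] at h
  simpa [total_zero] using h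

lemma integral_pairFree_zero_coupling {n : ℕ} (b : ℝ) (a u : ℝ≥0) :
    ∫ p, pairFree b 0 p ∂(pairLaw n a u u)
      = 2 * ∫ N, Real.log (ZpartBis b (natMat N)) ∂(poissonMat n (a + u)) := by
  have hi := integrable_of_abs_sub_le_total (abs_log_zpartBis_sub_le (n := n) b) (a + u)
  have h1 : Integrable (fun p : CountMat n × CountMat n => Real.log (ZpartBis b (natMat p.1)))
      (pairLaw n a u u) := by
    rwa [← map_fst_pairLaw a u u, integrable_map_measure .of_discrete
      Measurable.of_discrete.aemeasurable] at hi
  have h2 : Integrable (fun p : CountMat n × CountMat n => Real.log (ZpartBis b (natMat p.2)))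
      (pairLaw n a u u) := by
    rwa [← map_snd_pairLaw a u u, integrable_map_measure .of_discrete
      Measurable.of_discrete.aemeasurable] at hi
  simp_rw [pairFree_zero_coupling]
  rw [integral_add h1 h2, two_mul]
  congr 1
  · rw [← map_fst_pairLaw a u u, integral_map Measurable.of_discrete.aemeasurable .of_discrete]
  · rw [← map_snd_pairLaw a u u, integral_map Measurable.of_discrete.aemeasurable .of_discrete]

section symmetry
variable {n : ℕ}

lemma poissonMat_singleton (r : ℝ≥0) (N : CountMat n) :
    poissonMat n r {N} = ∏ i, ∏ j, poissonMeasure r {N i j} := by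
  unfold poissonMat
  rw [Measure.pi_singleton]
  exact Finset.prod_congr rfl fun i _ => Measure.pi_singleton _ _

lemma map_permute_poissonMat (r : ℝ≥0) (e : Equiv.Perm (Fin n)) :
    (poissonMat n r).map (fun N i j => N (e i) (e j)) = poissonMat n r := by
  refine Measure.ext_of_singleton fun N => ?_
  rw [Measure.map_apply .of_discrete (measurableSet_singleton _)]
  have : (fun (N : CountMat n) (i j : Fin n) => N (e i) (e j)) ⁻¹' {N}
      = {fun i j => N (e.symm i) (e.symm j)} := by
    ext M
    simp only [Set.mem_preimage, Set.mem_singleton_iff]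
    constructor
    · rintro rfl; simp
    · rintro rfl; simp
  rw [this, poissonMat_singleton, poissonMat_singleton,
    ← Equiv.prod_comp e.symm fun i => ∏ j, poissonMeasure r {N i j}]
  refine Finset.prod_congr rfl fun i _ => ?_
  rw [← Equiv.prod_comp e.symm fun j => poissonMeasure r {N (e.symm i) j}]

lemma ham_permute (e : Equiv.Perm (Fin n)) (X : Fin n → Fin n → ℝ) (σ : Fin n → Bool) :
    Ham (fun i j => X (e i) (e j)) (fun i => σ (e i)) = Ham X σ := by
  unfold Ham
  rw [← Equiv.sum_comp e fun i => ∑ j, X i j * spin (σ i) * spin (σ j)]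
  refine Finset.sum_congr rfl fun i _ => ?_
  rw [← Equiv.sum_comp e fun j => X (e i) j * spin (σ (e i)) * spin (σ j)]

lemma bisInd_permute (e : Equiv.Perm (Fin n)) (σ : Fin n → Bool) :
    bisInd (fun i => σ (e i)) = bisInd σ := by
  unfold bisInd isBis
  rw [Equiv.sum_comp e fun i => spin (σ i)]

lemma spin_not (c : Bool) : spin (!c) = -spin c := by cases c <;> simp [spin]

lemma ham_not (X : Fin n → Fin n → ℝ) (σ : Fin n → Bool) :
    Ham X (fun i => !σ i) = Ham X σ := by
  simp [Ham, spin_not]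

lemma bisInd_not (σ : Fin n → Bool) : bisInd (fun i => !σ i) = bisInd σ := by
  unfold bisInd isBis
  simp [spin_not, Finset.sum_neg_distrib]

lemma zpartBis_permute (b : ℝ) (e : Equiv.Perm (Fin n)) (X : Fin n → Fin n → ℝ) :
    ZpartBis b (fun i j => X (e i) (e j)) = ZpartBis b X := by
  rw [zpartBis_eq, zpartBis_eq,
    ← Equiv.sum_comp (e.symm.arrowCongr (Equiv.refl Bool))]
  refine Finset.sum_congr rfl fun σ _ => ?_
  have : (e.symm.arrowCongr (Equiv.refl Bool)) σ = fun i => σ (e i) := by ext i; simp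
  rw [this, ham_permute, bisInd_permute]

lemma gibbsBis_permute (b : ℝ) (e : Equiv.Perm (Fin n)) (X : Fin n → Fin n → ℝ)
    (σ : Fin n → Bool) :
    gibbsBis b (fun i j => X (e i) (e j)) (fun i => σ (e i)) = gibbsBis b X σ := by
  rw [gibbsBis_eq, gibbsBis_eq, ham_permute, bisInd_permute, zpartBis_permute]

lemma gibbsBis_not (b : ℝ) (X : Fin n → Fin n → ℝ) (σ : Fin n → Bool) :
    gibbsBis b X (fun i => !σ i) = gibbsBis b X σ := by
  rw [gibbsBis_eq, gibbsBis_eq, ham_not, bisInd_not]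

lemma integral_gibbsBis_permute (b : ℝ) (r : ℝ≥0) (e : Equiv.Perm (Fin n)) (σ : Fin n → Bool) :
    ∫ N, gibbsBis b (natMat N) (fun i => σ (e i)) ∂(poissonMat n r)
      = ∫ N, gibbsBis b (natMat N) σ ∂(poissonMat n r) := by
  conv_lhs => rw [← map_permute_poissonMat r e]
  rw [integral_map Measurable.of_discrete.aemeasurable .of_discrete]
  exact integral_congr_ae (Eventually.of_forall fun N => gibbsBis_permute b e (natMat N) σ)

lemma sum_spin_eq (σ : Fin n → Bool) :
    ∑ i, spin (σ i) = 2 * (Fintype.card {i // σ i = true} : ℝ) - n := by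
  have : ∀ i, spin (σ i) = 2 * (if σ i = true then (1 : ℝ) else 0) - 1 := fun i => by
    by_cases hi : σ i = true <;> simp [spin, hi]; norm_num
  simp_rw [this, Finset.sum_sub_distrib, ← Finset.mul_sum]
  simp [Fintype.card_subtype]

lemma exists_perm_of_card_eq {σ τ : Fin n → Bool}
    (h : Fintype.card {i // σ i = true} = Fintype.card {i // τ i = true}) :
    ∃ e : Equiv.Perm (Fin n), σ = fun i => τ (e i) := by
  obtain ⟨f⟩ := Fintype.card_eq.mp h
  refine ⟨f.extendSubtype, funext fun i => ?_⟩
  by_cases hi : σ i = true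
  · rw [hi, f.extendSubtype_mem i hi]
  · have h2 := f.extendSubtype_not_mem i hi
    simp only [Bool.not_eq_true] at hi h2
    rw [hi, h2]

lemma integral_gibbsBis_eq_of_isBis (b : ℝ) (r : ℝ≥0) {σ τ : Fin n → Bool} (hσ : isBis σ)
    (hτ : isBis τ) : ∫ N, gibbsBis b (natMat N) σ ∂(poissonMat n r)
      = ∫ N, gibbsBis b (natMat N) τ ∂(poissonMat n r) := by
  have hn : Fintype.card {i // (fun i => !τ i) i = true} + Fintype.card {i // τ i = true} = n := by
    have h1 := sum_spin_eq τ
    have h2 := sum_spin_eq fun i => !τ i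
    simp only [spin_not, Finset.sum_neg_distrib, h1] at h2
    have h3 : ((Fintype.card {i // (fun i => !τ i) i = true} + Fintype.card {i // τ i = true} : ℕ)
      : ℝ) = (n : ℝ) := by push_cast; linarith
    exact_mod_cast h3
  have key : ∀ {σ : Fin n → Bool}, isBis σ → 2 * Fintype.card {i // σ i = true} ≤ n + 1 ∧
      n ≤ 2 * Fintype.card {i // σ i = true} + 1 := fun {σ} hσ => by
    rw [isBis, sum_spin_eq, abs_le] at hσ
    constructor
    · have : (2 : ℝ) * (Fintype.card {i // σ i = true} : ℝ) ≤ n + 1 := by linarith [hσ.2]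
      exact_mod_cast this
    · have : (n : ℝ) ≤ 2 * (Fintype.card {i // σ i = true} : ℝ) + 1 := by linarith [hσ.1]
      exact_mod_cast this
  have kσ := key hσ
  have kτ := key hτ
  by_cases h : Fintype.card {i // σ i = true} = Fintype.card {i // τ i = true}
  · obtain ⟨e, rfl⟩ := exists_perm_of_card_eq h
    exact integral_gibbsBis_permute b r e τ
  · have h' : Fintype.card {i // σ i = true} = Fintype.card {i // (fun i => !τ i) i = true} := by
      omega
    obtain ⟨e, rfl⟩ := exists_perm_of_card_eq h'
    rw [integral_gibbsBis_permute b r e fun i => !τ i]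
    simp_rw [gibbsBis_not]

lemma integrable_gibbsBis (b : ℝ) (σ : Fin n → Bool) (μ : Measure (CountMat n))
    [IsFiniteMeasure μ] : Integrable (fun N => gibbsBis b (natMat N) σ) μ :=
  Integrable.of_bound .of_discrete 1 (Eventually.of_forall fun N => by
    rw [Real.norm_eq_abs, abs_of_nonneg (gibbsBis_nonneg b _ σ)]
    exact gibbsBis_le_one b _ σ)

lemma integral_gibbsBis (b : ℝ) (r : ℝ≥0) (τ : Fin n → Bool) :
    ∫ N, gibbsBis b (natMat N) τ ∂(poissonMat n r) = bisInd τ / bisCount n := by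
  by_cases hτ : isBis τ
  · have h1 : ∑ σ, ∫ N, gibbsBis b (natMat N) σ ∂(poissonMat n r) = 1 := by
      rw [← integral_finsetSum _ fun σ _ => integrable_gibbsBis b σ _]
      simp [sum_gibbsBis]
    have h2 : ∀ σ, ∫ N, gibbsBis b (natMat N) σ ∂(poissonMat n r)
        = bisInd σ * ∫ N, gibbsBis b (natMat N) τ ∂(poissonMat n r) := fun σ => by
      by_cases hσ : isBis σ
      · rw [integral_gibbsBis_eq_of_isBis b r hσ hτ, bisInd, if_pos hσ, one_mul]
      · simp [gibbsBis_eq, bisInd, hσ]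
    rw [Finset.sum_congr rfl fun σ _ => h2 σ, ← Finset.sum_mul] at h1
    rw [bisInd, if_pos hτ, eq_div_iff (bisCount_pos n).ne', mul_comm]
    exact h1
  · simp [gibbsBis_eq, bisInd, hτ]

end symmetry

lemma sum_exp_linear_le {n : ℕ} (σ : Fin n → Bool) (h : ℝ) :
    ∑ τ : Fin n → Bool, Real.exp (h * ∑ i, spin (σ i) * spin (τ i))
      ≤ 2 ^ n * Real.exp (n * (h ^ 2 / 2)) := by
  have e : ∑ τ : Fin n → Bool, Real.exp (h * ∑ i, spin (σ i) * spin (τ i))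
      = ∏ i : Fin n, ∑ c : Bool, Real.exp (h * (spin (σ i) * spin c)) := by
    rw [Finset.prod_univ_sum, Fintype.piFinset_univ]
    exact Finset.sum_congr rfl fun τ _ => by rw [Finset.mul_sum, Real.exp_sum]
  rw [e, Real.exp_nat_mul, ← mul_pow]
  have h2 : ∀ i : Fin n, ∑ c : Bool, Real.exp (h * (spin (σ i) * spin c)) = 2 * Real.cosh h :=
    fun i => by
      rw [Real.cosh_eq]
      cases σ i <;> simp [spin] <;> ring
  simp_rw [h2]
  rw [Finset.prod_const, Finset.card_univ, Fintype.card_fin]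
  have := Real.cosh_pos h
  gcongr
  exact Real.cosh_le_exp_half_sq h

lemma exists_int_eq_sum_spin {n : ℕ} (σ τ : Fin n → Bool) :
    ∃ v ∈ Finset.Icc (-(n : ℤ)) n, ((v : ℤ) : ℝ) = ∑ i, spin (σ i) * spin (τ i) := by
  have h : ∀ i, ∃ v : ℤ, (v : ℝ) = spin (σ i) * spin (τ i) := fun i => by
    rcases spin_mul_eq (σ i) (τ i) with h | h
    · exact ⟨1, by simp [h]⟩
    · exact ⟨-1, by simp [h]⟩
  choose v hv using h
  have e : ((∑ i, v i : ℤ) : ℝ) = ∑ i, spin (σ i) * spin (τ i) := by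
    push_cast; exact Finset.sum_congr rfl fun i _ => hv i
  refine ⟨∑ i, v i, ?_, e⟩
  have h1 : |∑ i, spin (σ i) * spin (τ i)| ≤ n := by
    refine (Finset.abs_sum_le_sum_abs _ _).trans ?_
    simp [abs_mul, abs_spin]
  rw [← e, abs_le] at h1
  rw [Finset.mem_Icc]
  exact ⟨by exact_mod_cast h1.1, by exact_mod_cast h1.2⟩

lemma sum_exp_overlap_sq_le {n : ℕ} (hn : 0 < n) {s : ℝ} (hs0 : 0 ≤ s) (hs : s ≤ 1 / 2)
    (σ : Fin n → Bool) :
    ∑ τ : Fin n → Bool, Real.exp (s * (n * overlap σ τ ^ 2)) ≤ (2 * n + 1) * 2 ^ n := by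
  have hn' : (0 : ℝ) < n := by exact_mod_cast hn
  have h1 : ∀ τ, Real.exp (s * (n * overlap σ τ ^ 2)) ≤ ∑ v ∈ Finset.Icc (-(n : ℤ)) n,
      Real.exp (-(s * v ^ 2 / n)) * Real.exp (2 * s * v / n * ∑ i, spin (σ i) * spin (τ i)) :=
    fun τ => by
      obtain ⟨v, hv, e⟩ := exists_int_eq_sum_spin σ τ
      refine le_trans (le_of_eq ?_) (Finset.single_le_sum (fun v _ => by positivity) hv)
      rw [← Real.exp_add, ← e]
      congr 1
      have h := sq_mul_overlap_sq σ τ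
      rw [← e] at h
      field_simp
      linear_combination s * h
  calc ∑ τ, Real.exp (s * (n * overlap σ τ ^ 2))
      ≤ ∑ τ : Fin n → Bool, ∑ v ∈ Finset.Icc (-(n : ℤ)) n,
        Real.exp (-(s * v ^ 2 / n)) * Real.exp (2 * s * v / n * ∑ i, spin (σ i) * spin (τ i)) :=
        Finset.sum_le_sum fun τ _ => h1 τ
    _ = ∑ v ∈ Finset.Icc (-(n : ℤ)) n, Real.exp (-(s * v ^ 2 / n)) *
          ∑ τ : Fin n → Bool, Real.exp (2 * s * v / n * ∑ i, spin (σ i) * spin (τ i)) := by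
        rw [Finset.sum_comm]; simp_rw [Finset.mul_sum]
    _ ≤ ∑ v ∈ Finset.Icc (-(n : ℤ)) n, (2 : ℝ) ^ n := by
        refine Finset.sum_le_sum fun v _ => ?_
        calc _ ≤ Real.exp (-(s * v ^ 2 / n)) *
              (2 ^ n * Real.exp (n * ((2 * s * v / n) ^ 2 / 2))) :=
              mul_le_mul_of_nonneg_left (sum_exp_linear_le σ _) (Real.exp_pos _).le
          _ = 2 ^ n * Real.exp (-(s * v ^ 2 / n) + n * ((2 * s * v / n) ^ 2 / 2)) := by
              rw [Real.exp_add]; ring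
          _ ≤ 2 ^ n * 1 := by
              refine mul_le_mul_of_nonneg_left (Real.exp_le_one_iff.mpr ?_) (by positivity)
              have e : -(s * v ^ 2 / n) + n * ((2 * s * v / n) ^ 2 / 2)
                  = -(s * (1 - 2 * s) * ((v : ℝ) ^ 2 / n)) := by field_simp; ring
              rw [e, neg_nonpos]
              have : 0 ≤ 1 - 2 * s := by linarith
              positivity
          _ = _ := mul_one _
    _ = _ := by
        rw [Finset.sum_const, Int.card_Icc, nsmul_eq_mul]
        congr 1
        have : ((n : ℤ) + 1 - -(n : ℤ)).toNat = 2 * n + 1 := by omega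
        rw [this]; push_cast; ring

lemma integral_pairFree_indep_le {n : ℕ} (hn : 0 < n) (b : ℝ) {s : ℝ} (hs0 : 0 ≤ s)
    (hs : s ≤ 1 / 2) (l : ℝ≥0) :
    ∫ p, pairFree b s p ∂(pairLaw n 0 l l)
      ≤ ∫ p, pairFree b 0 p ∂(pairLaw n 0 l l) + Real.log ((n + 1) * (2 * n + 1)) := by
  set a : ℝ := (n + 1) * (2 * n + 1) with ha
  have ha0 : 0 < a := by positivity
  set z : CountMat n × CountMat n → ℝ := fun p =>
    ∑ σ, ∑ τ, gibbsBis b (natMat p.1) σ * gibbsBis b (natMat p.2) τ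
        * Real.exp (s * (n * overlap σ τ ^ 2)) with hz
  have hterm (σ τ) : Integrable (fun p : CountMat n × CountMat n =>
      gibbsBis b (natMat p.1) σ * gibbsBis b (natMat p.2) τ
        * Real.exp (s * (n * overlap σ τ ^ 2))) (pairLaw n 0 l l) := by
    rw [pairLaw_zero_left]
    exact ((integrable_gibbsBis b σ _).mul_prod (integrable_gibbsBis b τ _)).mul_const _
  have hzi : Integrable z (pairLaw n 0 l l) :=
    integrable_finsetSum _ fun σ _ => integrable_finsetSum _ fun τ _ => hterm σ τ
  have hzpos : ∀ p, 0 < z p := fun p => by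
    have h := sum_mul_exp_pos (w := fun x : (Fin n → Bool) × (Fin n → Bool) =>
      gibbsBis b (natMat p.1) x.1 * gibbsBis b (natMat p.2) x.2)
      (fun x => mul_nonneg (gibbsBis_nonneg b _ _) (gibbsBis_nonneg b _ _))
      (by rw [Fintype.sum_prod_type, sum_gibbsBis_mul]; exact one_pos)
      fun x => s * (n * overlap x.1 x.2 ^ 2)
    rwa [Fintype.sum_prod_type] at h
  have hzint : ∫ p, z p ∂(pairLaw n 0 l l) ≤ a := by
    have e : ∫ p, z p ∂(pairLaw n 0 l l) =
        ∑ σ : Fin n → Bool, ∑ τ : Fin n → Bool, bisInd σ / bisCount n *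
        (bisInd τ / bisCount n) * Real.exp (s * (n * overlap σ τ ^ 2)) := by
      rw [hz, integral_finsetSum _ fun σ _ => integrable_finsetSum _ fun τ _ => hterm σ τ]
      refine Finset.sum_congr rfl fun σ _ => ?_
      rw [integral_finsetSum _ fun τ _ => hterm σ τ]
      refine Finset.sum_congr rfl fun τ _ => ?_
      rw [integral_mul_const, pairLaw_zero_left, integral_prod_mul
        (fun N => gibbsBis b (natMat N) σ) (fun N => gibbsBis b (natMat N) τ),
        integral_gibbsBis, integral_gibbsBis]
    have hB := bisCount_pos n
    have h1 : ∀ σ : Fin n → Bool, ∑ τ, bisInd σ / bisCount n * (bisInd τ / bisCount n) *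
        Real.exp (s * (n * overlap σ τ ^ 2)) ≤ bisInd σ / bisCount n * a := fun σ => by
      have h2 : ∑ τ, bisInd τ / bisCount n * Real.exp (s * (n * overlap σ τ ^ 2)) ≤ a := by
        calc _ ≤ ∑ τ, 1 / bisCount n * Real.exp (s * (n * overlap σ τ ^ 2)) := by
              refine Finset.sum_le_sum fun τ _ => ?_
              gcongr
              unfold bisInd; split_ifs <;> norm_num
          _ ≤ 1 / bisCount n * ((2 * n + 1) * 2 ^ n) := by
              rw [← Finset.mul_sum]
              gcongr
              exact sum_exp_overlap_sq_le hn hs0 hs σ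
          _ ≤ 1 / bisCount n * ((2 * n + 1) * ((n + 1) * bisCount n)) := by
              gcongr
              exact two_pow_le_bisCount n
          _ = a := by rw [ha]; field_simp
      simp_rw [mul_assoc (bisInd σ / bisCount n), ← Finset.mul_sum]
      exact mul_le_mul_of_nonneg_left h2 (div_nonneg (bisInd_nonneg _) hB.le)
    rw [e]
    refine (Finset.sum_le_sum fun σ _ => h1 σ).trans (le_of_eq ?_)
    rw [← Finset.sum_mul, ← Finset.sum_div, ← bisCount, div_self hB.ne', one_mul]
  have h0 := (lipPair_pairFree (n := n) b 0).integrable 0 l l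
  have hc : Integrable (fun p => z p / a + (Real.log a - 1)) (pairLaw n 0 l l) :=
    (hzi.div_const a).add (integrable_const _)
  have hmono := integral_mono ((lipPair_pairFree (n := n) b s).integrable 0 l l) (h0.add hc)
    fun p => by
      have h1 := Real.log_le_sub_one_of_pos (div_pos (hzpos p) ha0)
      rw [Real.log_div (hzpos p).ne' ha0.ne'] at h1
      simp only [Pi.add_apply]
      rw [pairFree_eq b p s, pairFree_zero_coupling]
      linarith
  have e1 := integral_add h0 hc
  have e2 := integral_add (hzi.div_const a) (integrable_const (μ := pairLaw n 0 l l)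
    (Real.log a - 1))
  rw [integral_div] at e2
  simp only [integral_const, probReal_univ, one_smul] at e2
  have h3 : (∫ p, z p ∂(pairLaw n 0 l l)) / a ≤ 1 := (div_le_one ha0).mpr hzint
  simp only [Pi.add_apply] at hmono
  linarith

/-- The overlap bound when little randomness is shared. -/
lemma overlapMean_le_of_small {n : ℕ} (hn : 0 < n) {b : ℝ} (hb : |Real.tanh b| ≤ 1 / 2)
    (a u : ℝ≥0) (ha : a * (n * Real.tanh b ^ 2) ≤ 1 / 4) :
    1 / 4 * (n * overlapMean n b a u)
      ≤ Real.log ((n + 1) * (2 * n + 1)) + a * (n ^ 2 * (24 * |Real.tanh b| ^ 3)) := by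
  have h1 := mul_overlapMean_le (n := n) b (1 / 4) a u
  have h2 := integral_pairFree_le (n := n) hb (1 / 4) a u
  have h3 := integral_pairFree_indep_le hn b (s := 1 / 4 + a * (n * Real.tanh b ^ 2))
    (by positivity) (by linarith) (u + a)
  rw [integral_pairFree_zero_coupling] at h1 h3
  rw [zero_add, add_comm u a] at h3
  rw [add_comm u a] at h2
  linarith

section superposition
variable {n : ℕ} {κ : Type*} [Fintype κ]

/-- The superposition of the point configurations selected by `x`. -/
def select (x : κ → Bool) (ω : κ → CountMat n) : CountMat n := ∑ k, if x k then ω k else 0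

lemma map_poissonMat_select (r : ℝ≥0) (x y : Bool) :
    (poissonMat n r).map (fun N => (if x then N else 0, if y then N else 0))
      = pairLaw n (if x && y then r else 0) (if x && !y then r else 0)
        (if !x && y then r else 0) := by
  cases x <;> cases y
  · simp [pairLaw_zero, Measure.map_const]
    rfl
  · simp [pairLaw_right]
  · simp [pairLaw_left]
  · simp [pairLaw_diag]

/-- Two selections from independent Poisson matrices share the matrices selected twice. -/
lemma map_select_pi (r : κ → ℝ≥0) (x y : κ → Bool) :
    (Measure.pi fun k => poissonMat n (r k)).map (fun ω => (select x ω, select y ω))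
      = pairLaw n (∑ k, if x k && y k then r k else 0) (∑ k, if x k && !y k then r k else 0)
        (∑ k, if !x k && y k then r k else 0) := by
  have h := map_finsetSum_pi_of_conv_semigroup (R := ℝ≥0 × ℝ≥0 × ℝ≥0)
    (fun k => poissonMat n (r k)) (fun ρ => pairLaw n ρ.1 ρ.2.1 ρ.2.2) pairLaw_zero
    (fun ρ ρ' => pairLaw_add ρ.1 ρ'.1 ρ.2.1 ρ'.2.1 ρ.2.2 ρ'.2.2)
    (fun k N => (if x k then N else 0, if y k then N else 0)) (fun _ => .of_discrete)
    (fun k => (if x k && y k then r k else 0, if x k && !y k then r k else 0,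
      if !x k && y k then r k else 0))
    (fun k => map_poissonMat_select (r k) (x k) (y k)) Finset.univ
  have e : ∀ ω : κ → CountMat n, (select x ω, select y ω)
      = ∑ k, (if x k then ω k else 0, if y k then ω k else 0) := fun ω => by
    ext1 <;> simp [select, Prod.fst_sum, Prod.snd_sum]
  simp_rw [e]
  simpa only [Prod.fst_sum, Prod.snd_sum] using h

lemma sum_and_add_sum_not (r : κ → ℝ≥0) (x y : κ → Bool) :
    (∑ k, if x k && y k then r k else 0) + (∑ k, if x k && !y k then r k else 0)
      = ∑ k, if x k then r k else 0 := by
  rw [← Finset.sum_add_distrib]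
  exact Finset.sum_congr rfl fun k _ => by cases x k <;> cases y k <;> simp

end superposition

lemma sum_prod_bool_of_forall_mem {κ : Type*} [Fintype κ] [DecidableEq κ] {w : Bool → ℝ≥0}
    (hw : w true + w false = 1) (s : Finset κ) :
    (∑ f : κ → Bool, if ∀ i ∈ s, f i then ∏ i, w (f i) else 0) = w true ^ s.card := by
  have h1 : ∀ f : κ → Bool, (if ∀ i ∈ s, f i then ∏ i, w (f i) else 0)
      = ∏ i, if i ∈ s ∧ f i = false then 0 else w (f i) := fun f => by
    split_ifs with h
    · refine Finset.prod_congr rfl fun i _ => ?_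
      rw [if_neg]
      rintro ⟨hi, h'⟩
      simp [h i hi] at h'
    · push Not at h
      obtain ⟨i, hi, h'⟩ := h
      refine (Finset.prod_eq_zero (Finset.mem_univ i) ?_).symm
      rw [if_pos ⟨hi, by simpa using h'⟩]
  simp_rw [h1]
  have h2 := Finset.prod_univ_sum (fun _ : κ => (Finset.univ : Finset Bool))
    (fun i c => if i ∈ s ∧ c = false then 0 else w c)
  rw [Fintype.piFinset_univ] at h2
  rw [← h2]
  have h3 : ∀ i, ∑ c : Bool, (if i ∈ s ∧ c = false then 0 else w c)
      = if i ∈ s then w true else 1 := fun i => by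
    by_cases hi : i ∈ s <;> simp [hi, hw]
  simp_rw [h3]
  rw [Finset.prod_ite_mem, Finset.univ_inter, Finset.prod_const]

section exchangeable
variable {L : ℕ} (c c' l : ℝ≥0)

/-- Rates of the pieces that build a Poisson matrix of rate `l` and `L` conditionally independent
resamplings of it: the piece `f` is shared by the resamplings `a` with `f a`, and each resampling
has a piece of its own. -/
noncomputable def pieceRate : (Fin L → Bool) ⊕ Fin L → ℝ≥0
  | .inl f => l * ∏ i, if f i then c else c'
  | .inr _ => c' * l

/-- The pieces of the original matrix. -/
def originalPieces : (Fin L → Bool) ⊕ Fin L → Bool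
  | .inl _ => true
  | .inr _ => false

/-- The pieces of the resampling `a`. -/
def resampledPieces (a : Fin L) : (Fin L → Bool) ⊕ Fin L → Bool
  | .inl f => f a
  | .inr i => decide (i = a)

variable {c c'}

lemma sum_rate_of_forall_mem (hc : c + c' = 1) (s : Finset (Fin L)) :
    (∑ f : Fin L → Bool, if ∀ i ∈ s, f i then l * ∏ i, (if f i then c else c') else 0)
      = l * c ^ s.card := by
  have h := sum_prod_bool_of_forall_mem (w := fun x => if x then c else c') (by simpa using hc) s
  simp only [if_true] at h
  rw [← h, Finset.mul_sum]
  exact Finset.sum_congr rfl fun f _ => by split_ifs <;> simp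

lemma sum_original (hc : c + c' = 1) :
    (∑ k, if originalPieces (L := L) k then pieceRate c c' l k else 0) = l := by
  simpa [Fintype.sum_sum_type, originalPieces, pieceRate]
    using sum_rate_of_forall_mem (L := L) l hc ∅

lemma sum_resampled (hc : c + c' = 1) (a : Fin L) :
    (∑ k, if resampledPieces a k then pieceRate c c' l k else 0) = l := by
  have h := sum_rate_of_forall_mem l hc {a}
  simp only [Finset.mem_singleton, forall_eq, Finset.card_singleton, pow_one] at h
  have h' : (∑ i : Fin L, if i = a then c' * l else 0) = c' * l := by simp
  have e := congrArg₂ (· + ·) h h'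
  simp only [mul_comm c', ← mul_add, hc, mul_one] at e
  simpa [Fintype.sum_sum_type, resampledPieces, pieceRate, mul_comm c'] using e

lemma sum_original_resampled (hc : c + c' = 1) (a : Fin L) :
    (∑ k, if originalPieces k && resampledPieces a k then pieceRate c c' l k else 0) = c * l := by
  have h := sum_rate_of_forall_mem l hc {a}
  simp only [Finset.mem_singleton, forall_eq, Finset.card_singleton, pow_one] at h
  simpa [Fintype.sum_sum_type, resampledPieces, originalPieces, pieceRate, mul_comm c] using h

lemma sum_resampled_resampled (hc : c + c' = 1) {a a' : Fin L} (ha : a ≠ a') :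
    (∑ k, if resampledPieces a k && resampledPieces a' k then pieceRate c c' l k else 0)
      = c ^ 2 * l := by
  have h := sum_rate_of_forall_mem l hc {a, a'}
  have h0 : ∀ i : Fin L, ¬ (i = a ∧ i = a') := fun i hi => ha (hi.1.symm.trans hi.2)
  simp only [Finset.mem_insert, Finset.mem_singleton, forall_eq_or_imp, forall_eq,
    Finset.card_pair ha] at h
  simpa [Fintype.sum_sum_type, resampledPieces, pieceRate, mul_comm (c ^ 2), h0] using h

lemma map_select_pieces {n : ℕ} {x y : (Fin L → Bool) ⊕ Fin L → Bool} {a u : ℝ≥0}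
    (hx : (∑ k, if x k then pieceRate c c' l k else 0) = l)
    (hy : (∑ k, if y k then pieceRate c c' l k else 0) = l)
    (hxy : (∑ k, if x k && y k then pieceRate c c' l k else 0) = a) (hl : a + u = l) :
    (Measure.pi fun k => poissonMat n (pieceRate c c' l k)).map
      (fun ω => (select x ω, select y ω)) = pairLaw n a u u := by
  have h1 := sum_and_add_sum_not (pieceRate c c' l) x y
  have h2 := sum_and_add_sum_not (pieceRate c c' l) y x
  simp only [Bool.and_comm (y _)] at h2
  replace h1 := h1.trans (hx.trans hl.symm)
  replace h2 := h2.trans (hy.trans hl.symm)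
  rw [hxy] at h1 h2
  rw [map_select_pi, hxy, add_left_cancel h1, add_left_cancel h2]

end exchangeable

/-- The correlations of pairs of spins under the Gibbs measure. -/
noncomputable def spinCorr {n : ℕ} (b : ℝ) (N : CountMat n) (e : Fin n × Fin n) : ℝ :=
  1 / n * ∑ σ, spin (σ e.1) * spin (σ e.2) * gibbsBis b (natMat N) σ

/-- The coupled second moment of the overlap. -/
noncomputable def overlapKernel {n : ℕ} (b : ℝ) (M N : CountMat n) : ℝ :=
  avg2cBis b (natMat M) (natMat N) fun σ τ => overlap σ τ ^ 2

lemma overlapKernel_eq_sum {n : ℕ} (b : ℝ) (M N : CountMat n) :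
    overlapKernel b M N = ∑ e, spinCorr b M e * spinCorr b N e := by
  have h : ∀ σ τ : Fin n → Bool, overlap σ τ ^ 2
      = ∑ e : Fin n × Fin n, (1 / n * (spin (σ e.1) * spin (σ e.2)))
        * (1 / n * (spin (τ e.1) * spin (τ e.2))) := fun σ τ => by
    have h := sq_mul_overlap_sq_eq_sum σ τ
    rw [Fintype.sum_prod_type]
    rcases Nat.eq_zero_or_pos n with rfl | hn
    · simp [overlap]
    · have : (n : ℝ) ≠ 0 := by positivity
      rw [← mul_right_inj' (pow_ne_zero 2 this), h, Finset.mul_sum]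
      refine Finset.sum_congr rfl fun i _ => ?_
      rw [Finset.mul_sum]
      refine Finset.sum_congr rfl fun j _ => ?_
      field_simp
  have h' : ∀ e, spinCorr b M e * spinCorr b N e = ∑ σ, ∑ τ,
      (1 / n * (spin (σ e.1) * spin (σ e.2))) * (1 / n * (spin (τ e.1) * spin (τ e.2)))
        * gibbsBis b (natMat M) σ * gibbsBis b (natMat N) τ := fun e => by
    rw [spinCorr, spinCorr, Finset.mul_sum, Finset.mul_sum, Finset.sum_mul_sum]
    exact Finset.sum_congr rfl fun σ _ => Finset.sum_congr rfl fun τ _ => by ring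
  simp_rw [h']
  rw [Finset.sum_comm, overlapKernel, avg2cBis]
  refine Finset.sum_congr rfl fun σ _ => ?_
  rw [Finset.sum_comm]
  refine Finset.sum_congr rfl fun τ _ => ?_
  rw [h, Finset.sum_mul, Finset.sum_mul]

lemma two_mul_sum_overlapKernel_le {n L : ℕ} (b x : ℝ) (M : CountMat n)
    (N : Fin L → CountMat n) :
    2 * x * ∑ a, overlapKernel b M (N a)
      ≤ x ^ 2 + ∑ a, ∑ a', overlapKernel b (N a) (N a') := by
  have h0 : overlapKernel b M M ≤ 1 := avg2cBis_overlap_le_one b (M, M)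
  have h1 : 0 ≤ ∑ e, (x * spinCorr b M e - ∑ a, spinCorr b (N a) e) ^ 2 :=
    Finset.sum_nonneg fun e _ => sq_nonneg _
  have h2 : ∑ e, (x * spinCorr b M e - ∑ a, spinCorr b (N a) e) ^ 2
      = x ^ 2 * overlapKernel b M M - 2 * x * ∑ a, overlapKernel b M (N a)
        + ∑ a, ∑ a', overlapKernel b (N a) (N a') := by
    have e1 : ∑ a, overlapKernel b M (N a) = ∑ e, spinCorr b M e * ∑ a, spinCorr b (N a) e := by
      simp_rw [overlapKernel_eq_sum, Finset.mul_sum]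
      exact Finset.sum_comm
    have e2 : ∑ a, ∑ a', overlapKernel b (N a) (N a')
        = ∑ e, (∑ a, spinCorr b (N a) e) * ∑ a, spinCorr b (N a) e := by
      simp_rw [overlapKernel_eq_sum, Finset.sum_mul_sum]
      simp_rw [Finset.sum_comm (s := Finset.univ (α := Fin L))
        (t := Finset.univ (α := Fin n × Fin n))]
    rw [e1, e2, overlapKernel_eq_sum]
    rw [Finset.mul_sum, Finset.mul_sum, ← Finset.sum_sub_distrib, ← Finset.sum_add_distrib]
    exact Finset.sum_congr rfl fun e _ => by ring
  nlinarith [sq_nonneg x]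

lemma integral_overlapKernel_of_map {Ω : Type*} [MeasurableSpace Ω] [DiscreteMeasurableSpace Ω]
    {P : Measure Ω} {n : ℕ} {X Y : Ω → CountMat n} {a u : ℝ≥0}
    (h : P.map (fun ω => (X ω, Y ω)) = pairLaw n a u u) (b : ℝ) :
    ∫ ω, overlapKernel b (X ω) (Y ω) ∂P = overlapMean n b a u := by
  rw [overlapMean, ← h, integral_map Measurable.of_discrete.aemeasurable .of_discrete]
  rfl

lemma integrable_overlapKernel {Ω : Type*} [MeasurableSpace Ω] [DiscreteMeasurableSpace Ω]
    [Countable Ω] {P : Measure Ω} [IsFiniteMeasure P] {n : ℕ} (X Y : Ω → CountMat n) (b : ℝ) :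
    Integrable (fun ω => overlapKernel b (X ω) (Y ω)) P :=
  Integrable.of_bound .of_discrete 1 (Eventually.of_forall fun ω => by
    rw [Real.norm_eq_abs, overlapKernel, abs_of_nonneg (avg2cBis_overlap_nonneg b (X ω, Y ω))]
    exact avg2cBis_overlap_le_one b (X ω, Y ω))

/-- Squaring the correlation of the disorders at most takes the square root of the overlap. -/
lemma overlapMean_sq_le {c c' : ℝ≥0} (hc : c + c' = 1) (n : ℕ) (b : ℝ) (l : ℝ≥0) :
    overlapMean n b (c * l) (c' * l) ^ 2 ≤ overlapMean n b (c ^ 2 * l) ((1 + c) * c' * l) := by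
  set ρ := overlapMean n b (c * l) (c' * l) with hρ
  set ρ' := overlapMean n b (c ^ 2 * l) ((1 + c) * c' * l) with hρ'
  have hl : c * l + c' * l = l := by rw [← add_mul, hc, one_mul]
  have hl' : c ^ 2 * l + (1 + c) * c' * l = l := by
    calc c ^ 2 * l + (1 + c) * c' * l = (c * (c + c') + c') * l := by ring
      _ = l := by rw [hc, mul_one, hc, one_mul]
  have key : ∀ L : ℕ, 0 < L → ρ ^ 2 ≤ ρ' + 1 / L := fun L hL => by
    set P := Measure.pi fun k : (Fin L → Bool) ⊕ Fin L => poissonMat n (pieceRate c c' l k)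
    have hZ : ∀ a : Fin L, ∫ ω, overlapKernel b (select originalPieces ω)
        (select (resampledPieces a) ω) ∂P = ρ := fun a =>
      integral_overlapKernel_of_map (map_select_pieces l (sum_original l hc)
        (sum_resampled l hc a) (sum_original_resampled l hc a) hl) b
    have hY : ∀ a a' : Fin L, ∫ ω, overlapKernel b (select (resampledPieces a) ω)
        (select (resampledPieces a') ω) ∂P ≤ ρ' + if a = a' then 1 else 0 := fun a a' => by
      split_ifs with h
      · have h1 : ∫ ω, overlapKernel b (select (resampledPieces a) ω)
            (select (resampledPieces a') ω) ∂P ≤ ∫ _, (1 : ℝ) ∂P :=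
          integral_mono (integrable_overlapKernel _ _ b) (integrable_const 1)
            fun ω => avg2cBis_overlap_le_one b (_, _)
        have h2 := overlapMean_nonneg n b (c ^ 2 * l) ((1 + c) * c' * l)
        simp only [integral_const, probReal_univ, one_smul] at h1
        linarith
      · rw [integral_overlapKernel_of_map (map_select_pieces l (sum_resampled l hc a)
          (sum_resampled l hc a') (sum_resampled_resampled l hc h) hl') b, add_zero]
    have hmono := integral_mono (μ := P)
      ((integrable_finsetSum Finset.univ fun a _ => integrable_overlapKernel
        (select originalPieces) (select (resampledPieces a)) b).const_mul (2 * (L * ρ)))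
      ((integrable_const ((L * ρ) ^ 2)).add (integrable_finsetSum Finset.univ fun a _ =>
        integrable_finsetSum Finset.univ fun a' _ => integrable_overlapKernel
          (select (resampledPieces a)) (select (resampledPieces a')) b))
      fun ω => two_mul_sum_overlapKernel_le b (L * ρ) (select originalPieces ω)
        fun a : Fin L => select (resampledPieces a) ω
    simp only [Pi.add_apply] at hmono
    rw [integral_const_mul, integral_finsetSum _ fun a _ => integrable_overlapKernel _ _ b,
      integral_add (integrable_const _) (integrable_finsetSum _ fun a _ =>
        integrable_finsetSum _ fun a' _ => integrable_overlapKernel _ _ b),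
      integral_finsetSum _ fun a _ =>
        integrable_finsetSum _ fun a' _ => integrable_overlapKernel _ _ b] at hmono
    simp_rw [integral_finsetSum Finset.univ fun a' _ => integrable_overlapKernel _ _ b, hZ]
      at hmono
    have hsum := Finset.sum_le_sum fun a (_ : a ∈ Finset.univ) =>
      Finset.sum_le_sum fun a' (_ : a' ∈ Finset.univ) => hY a a'
    have hL' : (0 : ℝ) < L := by exact_mod_cast hL
    have e : ∑ a : Fin L, ∑ a' : Fin L, (ρ' + if a = a' then 1 else 0) = L ^ 2 * ρ' + L := by
      simp [Finset.sum_add_distrib]; ring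
    rw [e] at hsum
    simp only [integral_const, probReal_univ, one_smul, Finset.sum_const, Finset.card_univ,
      Fintype.card_fin, nsmul_eq_mul] at hmono
    have h3 : (L : ℝ) ^ 2 * ρ ^ 2 ≤ L ^ 2 * (ρ' + 1 / L) := by
      have : (L : ℝ) ^ 2 * (ρ' + 1 / L) = L ^ 2 * ρ' + L := by field_simp
      rw [this]
      linarith
    exact le_of_mul_le_mul_left h3 (by positivity)
  have hlim : Tendsto (fun L : ℕ => ρ' + 1 / ((L : ℝ) + 1)) atTop (nhds (ρ' + 0)) :=
    tendsto_one_div_add_atTop_nhds_zero_nat.const_add ρ'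
  rw [add_zero] at hlim
  exact ge_of_tendsto' hlim fun L => by simpa using key (L + 1) L.succ_pos

lemma sinh_le_mul_cosh {x : ℝ} (hx : 0 ≤ x) : Real.sinh x ≤ x * Real.cosh x := by
  have hd : ∀ y : ℝ, HasDerivAt (fun y => y * Real.cosh y - Real.sinh y) (y * Real.sinh y) y :=
    fun y => by
      refine (((hasDerivAt_id' y).fun_mul (Real.hasDerivAt_cosh y)).fun_sub
        (Real.hasDerivAt_sinh y)).congr_deriv ?_
      ring
  have hm : MonotoneOn (fun y => y * Real.cosh y - Real.sinh y) (Set.Ici 0) :=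
    monotoneOn_of_deriv_nonneg (convex_Ici 0) (fun y _ => (hd y).continuousAt.continuousWithinAt)
      (fun y _ => (hd y).differentiableAt.differentiableWithinAt) fun y hy => by
        rw [interior_Ici, Set.mem_Ioi] at hy
        rw [(hd y).deriv]
        exact mul_nonneg hy.le (Real.sinh_nonneg_iff.mpr hy.le)
  have := hm (Set.mem_Ici.mpr le_rfl) hx hx
  simp only [zero_mul, Real.sinh_zero, sub_zero] at this
  linarith

lemma abs_tanh_le (x : ℝ) : |Real.tanh x| ≤ |x| := by
  rw [Real.tanh_eq_sinh_div_cosh, abs_div, Real.abs_sinh, abs_of_pos (Real.cosh_pos x),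
    div_le_iff₀ (Real.cosh_pos x), ← Real.cosh_abs x]
  exact sinh_le_mul_cosh (abs_nonneg x)

lemma tendsto_log_mul_div_atTop :
    Tendsto (fun n : ℕ => Real.log ((n + 1) * (2 * n + 1)) / n) atTop (nhds 0) := by
  have h1 := Real.tendsto_pow_log_div_mul_add_atTop (1 / 2) (-(1 / 2)) 1 (by norm_num)
  have h2 : Tendsto (fun n : ℕ => 2 * (n : ℝ) + 1) atTop atTop :=
    tendsto_atTop_add_const_right _ _ (tendsto_natCast_atTop_atTop.const_mul_atTop two_pos)
  have h3 := (h1.comp h2).const_mul 2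
  rw [mul_zero] at h3
  refine squeeze_zero (fun n => ?_) (fun n => ?_) h3
  · have : (0 : ℝ) ≤ n := n.cast_nonneg
    exact div_nonneg (Real.log_nonneg (by nlinarith)) this
  · have hn : (0 : ℝ) ≤ n := n.cast_nonneg
    have e : 1 / 2 * (2 * (n : ℝ) + 1) + -(1 / 2) = n := by ring
    simp only [Function.comp_apply, pow_one, e]
    rw [← mul_div_assoc]
    gcongr
    have h : Real.log ((2 * n + 1 : ℝ) ^ 2) = 2 * Real.log (2 * n + 1) := by
      rw [Real.log_pow]; norm_num
    rw [← h]
    exact Real.log_le_log (by positivity) (by nlinarith)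

/-- The rate of the entries of the sparse disorder. -/
noncomputable def sparseRate (n : ℕ) (d : ℝ) : ℝ≥0 := (d / (2 * n)).toNNReal

lemma overlapMean_sparse_le {β d : ℝ} (hd : 0 < d) (hd' : 4 * β ^ 2 ≤ d) {c : ℝ≥0} (hc1 : c ≤ 1)
    (hc : c * β ^ 2 ≤ 1 / 2) {n : ℕ} (hn : 0 < n) (u : ℝ≥0) :
    overlapMean n (β / √d) (c * sparseRate n d) u
      ≤ 4 * (Real.log ((n + 1) * (2 * n + 1)) / n) + 48 * |β| ^ 3 / √d := by
  have hn' : (0 : ℝ) < n := by exact_mod_cast hn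
  have hs : 0 < √d := Real.sqrt_pos.mpr hd
  have hsq : √d ^ 2 = d := Real.sq_sqrt hd.le
  have ht : |Real.tanh (β / √d)| ≤ |β| / √d :=
    (abs_tanh_le _).trans_eq (by rw [abs_div, abs_of_pos hs])
  have hl : (sparseRate n d : ℝ) = d / (2 * n) := Real.coe_toNNReal _ (by positivity)
  have hhalf : |β| / √d ≤ 1 / 2 := by
    rw [div_le_iff₀ hs]
    refine abs_le_of_sq_le_sq' ?_ (by positivity) |>.2
    rw [sq_abs, mul_pow, hsq]
    linarith
  have ha : ((c * sparseRate n d : ℝ≥0) : ℝ) * (n * Real.tanh (β / √d) ^ 2) ≤ 1 / 4 := by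
    have h1 : Real.tanh (β / √d) ^ 2 ≤ β ^ 2 / d := by
      calc Real.tanh (β / √d) ^ 2 = |Real.tanh (β / √d)| ^ 2 := (sq_abs _).symm
        _ ≤ (|β| / √d) ^ 2 := by gcongr
        _ = β ^ 2 / d := by rw [div_pow, sq_abs, hsq]
    calc ((c * sparseRate n d : ℝ≥0) : ℝ) * (n * Real.tanh (β / √d) ^ 2)
        ≤ (c * sparseRate n d : ℝ≥0) * (n * (β ^ 2 / d)) := by gcongr
      _ = c * β ^ 2 / 2 := by rw [NNReal.coe_mul, hl]; field_simp
      _ ≤ 1 / 4 := by linarith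
  have h := overlapMean_le_of_small hn (ht.trans hhalf) _ u ha
  have h2 : ((c * sparseRate n d : ℝ≥0) : ℝ) * (n ^ 2 * (24 * |Real.tanh (β / √d)| ^ 3))
      ≤ 12 * n * |β| ^ 3 / √d := by
    calc ((c * sparseRate n d : ℝ≥0) : ℝ) * (n ^ 2 * (24 * |Real.tanh (β / √d)| ^ 3))
        ≤ (1 * sparseRate n d : ℝ≥0) * (n ^ 2 * (24 * (|β| / √d) ^ 3)) := by gcongr
      _ = 12 * n * |β| ^ 3 / √d := by
        rw [one_mul, hl]
        nth_rw 1 [← hsq]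
        field_simp
        ring
  rw [← mul_le_mul_iff_of_pos_left hn']
  calc (n : ℝ) * overlapMean n (β / √d) (c * sparseRate n d) u
      ≤ 4 * (Real.log ((n + 1) * (2 * n + 1)) + 12 * n * |β| ^ 3 / √d) := by linarith
    _ = n * (4 * (Real.log ((n + 1) * (2 * n + 1)) / n) + 48 * |β| ^ 3 / √d) := by
      field_simp; ring

/-- The overlap of the Gibbs measures of sparse disorders with correlation `c` vanishes. -/
def OverlapVanishes (β : ℝ) (c : ℝ≥0) : Prop :=
  ∀ ε > 0, ∀ᶠ d : ℝ in atTop, ∀ᶠ n : ℕ in atTop,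
    overlapMean n (β / √d) (c * sparseRate n d) ((1 - c) * sparseRate n d) ≤ ε

lemma overlapVanishes_of_small {β : ℝ} {c : ℝ≥0} (hc1 : c ≤ 1) (hc : c * β ^ 2 ≤ 1 / 2) :
    OverlapVanishes β c := fun ε hε => by
  have h1 : Tendsto (fun d : ℝ => 48 * |β| ^ 3 / √d) atTop (nhds 0) :=
    tendsto_const_nhds.div_atTop Real.tendsto_sqrt_atTop
  have h2 := tendsto_log_mul_div_atTop.const_mul 4
  rw [mul_zero] at h2
  filter_upwards [h1.eventually_le_const (half_pos hε), eventually_gt_atTop 0,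
    eventually_ge_atTop (4 * β ^ 2)] with d hd hd0 hd4
  filter_upwards [h2.eventually_le_const (half_pos hε), eventually_gt_atTop 0] with n hn hn0
  linarith [overlapMean_sparse_le hd0 hd4 hc1 hc hn0 ((1 - c) * sparseRate n d)]

lemma OverlapVanishes.of_sq {β : ℝ} {c : ℝ≥0} (hc : c ≤ 1) (h : OverlapVanishes β (c ^ 2)) :
    OverlapVanishes β c := fun ε hε => by
  have h1 : (1 + c) * (1 - c) = 1 - c ^ 2 := by
    rw [← NNReal.coe_inj]
    push_cast [NNReal.coe_sub hc, NNReal.coe_sub (pow_le_one₀ (zero_le) hc : c ^ 2 ≤ 1)]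
    ring
  filter_upwards [h (ε ^ 2) (by positivity)] with d hd
  filter_upwards [hd] with n hn
  refine le_of_sq_le_sq ?_ hε.le
  rw [← h1] at hn
  exact (overlapMean_sq_le (add_tsub_cancel_of_le hc) n _ _).trans hn

lemma overlapVanishes_of_pow_two_pow {β : ℝ} {c : ℝ≥0} (hc : c ≤ 1) :
    ∀ k : ℕ, OverlapVanishes β (c ^ 2 ^ k) → OverlapVanishes β c
  | 0, h => by simpa using h
  | k + 1, h => overlapVanishes_of_pow_two_pow hc k <|
      .of_sq (pow_le_one₀ zero_le hc) (by rwa [← pow_mul, ← pow_succ])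

lemma overlapVanishes_of_lt_one (β : ℝ) {c : ℝ≥0} (hc : c < 1) : OverlapVanishes β c := by
  have h1 : Tendsto (fun k : ℕ => (c : ℝ) ^ 2 ^ k * β ^ 2) atTop (nhds (0 * β ^ 2)) :=
    ((tendsto_pow_atTop_nhds_zero_of_lt_one c.coe_nonneg hc).comp
      (tendsto_pow_atTop_atTop_of_one_lt one_lt_two)).mul_const _
  rw [zero_mul] at h1
  obtain ⟨k, hk⟩ := (h1.eventually_le_const (half_pos one_pos)).exists
  exact overlapVanishes_of_pow_two_pow hc.le k
    (overlapVanishes_of_small (pow_le_one₀ zero_le hc.le) (by exact_mod_cast hk))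

lemma integral_coupledSparse {t : ℝ} (ht0 : 0 ≤ t) (ht1 : t ≤ 1) (n : ℕ) (d b : ℝ) :
    ∫ w, avg2cBis b (natMat (w.1 + w.2.1)) (natMat (w.1 + w.2.2))
        (fun σ1 σ2 => (overlap σ1 σ2) ^ 2) ∂(coupledSparse n d t)
      = overlapMean n b ((1 - t).toNNReal * sparseRate n d)
        ((1 - (1 - t).toNNReal) * sparseRate n d) := by
  have h : ∀ s : ℝ, 0 ≤ s → sparseMeasure n (s * d) = poissonMat n (s.toNNReal * sparseRate n d) :=
    fun s hs => by
      rw [sparseMeasure, poissonMat, sparseRate, ← Real.toNNReal_mul hs, mul_div_assoc]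
  have ht : 1 - (1 - t).toNNReal = t.toNNReal := by
    refine tsub_eq_of_eq_add ?_
    rw [← Real.toNNReal_add ht0 (sub_nonneg.mpr ht1)]
    simp
  rw [overlapMean, ht, pairLaw_eq_map,
    integral_map Measurable.of_discrete.aemeasurable .of_discrete, coupledSparse, h _ (sub_nonneg.mpr ht1), h _ ht0]

/-- disorder chaos for the sparse bisection model. -/
theorem stmt_7 (t : ℝ) (ht0 : 0 < t) (ht1 : t ≤ 1) (β : ℝ) :
    Tendsto (fun d : ℝ => limsup (fun n : ℕ =>
        ∫ w, avg2cBis (β / Real.sqrt d) (natMat (w.1 + w.2.1)) (natMat (w.1 + w.2.2))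
          (fun σ1 σ2 => (overlap σ1 σ2) ^ 2) ∂(coupledSparse n d t)) atTop) atTop (nhds 0) := by
  have hc : (1 - t).toNNReal < 1 := by
    rw [Real.toNNReal_lt_one]; linarith
  simp_rw [integral_coupledSparse ht0.le ht1]
  rw [Metric.tendsto_nhds]
  intro ε hε
  filter_upwards [overlapVanishes_of_lt_one β hc (ε / 2) (half_pos hε)] with d hd
  have hb : IsBoundedUnder (· ≤ ·) atTop fun n : ℕ => overlapMean n (β / √d)
      ((1 - t).toNNReal * sparseRate n d) ((1 - (1 - t).toNNReal) * sparseRate n d) :=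
    isBoundedUnder_of ⟨1, fun n => overlapMean_le_one _ _ _ _⟩
  have hb' : IsBoundedUnder (· ≥ ·) atTop fun n : ℕ => overlapMean n (β / √d)
      ((1 - t).toNNReal * sparseRate n d) ((1 - (1 - t).toNNReal) * sparseRate n d) :=
    isBoundedUnder_of ⟨0, fun n => overlapMean_nonneg _ _ _ _⟩
  have h1 := limsup_le_of_le hb'.isCoboundedUnder_le hd
  have h2 := le_limsup_of_frequently_le
    (Frequently.of_forall fun n => overlapMean_nonneg n (β / √d)
      ((1 - t).toNNReal * sparseRate n d) ((1 - (1 - t).toNNReal) * sparseRate n d)) hb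
  rw [Real.dist_eq, sub_zero, abs_of_nonneg h2]
  linarith
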